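/- arXiv:1607.07020 — 10 statements merged into one kernel-verified Lean document; each statement's English description precedes it below -/
import Mathlib

section
/- Let (c₁,…,c₇) ∈ ℝ⁷ satisfy c₁c₄ − c₂c₆ = 0, c₃c₄ − c₂c₇ = 0 and c₃c₆ − c₁c₇ = 0. Then the contravariant metric on ℝ² (coordinates u¹,u²) with components g¹¹ = c₁u¹ + c₂u² + c₃, g¹² = g²¹ = c₄u¹ + c₁u² + c₅, g²² = c₆u¹ + c₄u² + c₇ is flat on the open set where det(g^{ij}) ≠ 0. -/
open Matrix

/-- Partial derivative in direction `i` (0 ↦ ∂/∂u¹, 1 ↦ ∂/∂u²) of a function of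
two real variables. -/
noncomputable def pd (i : Fin 2) (f : ℝ → ℝ → ℝ) (x y : ℝ) : ℝ :=
  if i = 0 then deriv (fun s => f s y) x else deriv (fun s => f x s) y

/-- The covariant components `g_{lk}` of a contravariant metric `g`, i.e. the
entries of the inverse matrix. -/
noncomputable def covMetric (g : ℝ → ℝ → Matrix (Fin 2) (Fin 2) ℝ)
    (l k : Fin 2) (x y : ℝ) : ℝ :=
  ((g x y)⁻¹) l k

/-- Christoffel symbols `Γ^i_{jk}` of the Levi-Civita connection of the
contravariant metric `g`:
`Γ^i_{jk} = (1/2) g^{il} (∂_j g_{lk} + ∂_k g_{lj} − ∂_l g_{jk})`. -/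
noncomputable def christoffel (g : ℝ → ℝ → Matrix (Fin 2) (Fin 2) ℝ)
    (i j k : Fin 2) (x y : ℝ) : ℝ :=
  ∑ l, (1 / 2 : ℝ) * g x y i l *
    (pd j (covMetric g l k) x y + pd k (covMetric g l j) x y
      - pd l (covMetric g j k) x y)

/-- Riemann curvature tensor
`R^i_{jkl} = ∂_k Γ^i_{lj} − ∂_l Γ^i_{kj} + Γ^i_{km} Γ^m_{lj} − Γ^i_{lm} Γ^m_{kj}`. -/
noncomputable def riemann (g : ℝ → ℝ → Matrix (Fin 2) (Fin 2) ℝ)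
    (i j k l : Fin 2) (x y : ℝ) : ℝ :=
  pd k (christoffel g i l j) x y - pd l (christoffel g i k j) x y
    + ∑ m, (christoffel g i k m x y * christoffel g m l j x y
        - christoffel g i l m x y * christoffel g m k j x y)

/-- `(α g¹¹ + β g¹² + γ g²²) / det g` for the affine metric. -/
noncomputable def FF (c₁ c₂ c₃ c₄ c₅ c₆ c₇ α β γ x y : ℝ) : ℝ :=
  (α * (c₁ * x + c₂ * y + c₃) + β * (c₄ * x + c₁ * y + c₅) + γ * (c₆ * x + c₄ * y + c₇)) /
    ((c₁ * x + c₂ * y + c₃) * (c₆ * x + c₄ * y + c₇) - (c₄ * x + c₁ * y + c₅) ^ 2)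

lemma aff_deriv (p q x : ℝ) : HasDerivAt (fun s : ℝ => p * s + q) p x := by
  simpa using ((hasDerivAt_id x).const_mul p).add_const q

lemma quot_deriv (α β γ a1 a0 b1 b0 d1 d0 x : ℝ)
    (hD : (a1 * x + a0) * (d1 * x + d0) - (b1 * x + b0) ^ 2 ≠ 0) :
    deriv (fun s : ℝ => (α * (a1 * s + a0) + β * (b1 * s + b0) + γ * (d1 * s + d0)) /
      ((a1 * s + a0) * (d1 * s + d0) - (b1 * s + b0) ^ 2)) x =
    ((α * a1 + β * b1 + γ * d1) * ((a1 * x + a0) * (d1 * x + d0) - (b1 * x + b0) ^ 2)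
      - (α * (a1 * x + a0) + β * (b1 * x + b0) + γ * (d1 * x + d0)) *
        (a1 * (d1 * x + d0) + (a1 * x + a0) * d1 - 2 * (b1 * x + b0) * b1)) /
      ((a1 * x + a0) * (d1 * x + d0) - (b1 * x + b0) ^ 2) ^ 2 := by
  have ha := aff_deriv a1 a0 x
  have hb := aff_deriv b1 b0 x
  have hd := aff_deriv d1 d0 x
  have hn := ((ha.const_mul α).add (hb.const_mul β)).add (hd.const_mul γ)
  have hq := (ha.mul hd).sub (hb.pow 2)
  have h := (hn.div hq hD).deriv
  refine Eq.trans h ?_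
  simp

lemma pd_zero_FF (c₁ c₂ c₃ c₄ c₅ c₆ c₇ α β γ x y a b d D : ℝ)
    (ha : a = c₁ * x + c₂ * y + c₃) (hb : b = c₄ * x + c₁ * y + c₅)
    (hd : d = c₆ * x + c₄ * y + c₇) (hDD : D = a * d - b ^ 2) (hD : D ≠ 0) :
    pd 0 (FF c₁ c₂ c₃ c₄ c₅ c₆ c₇ α β γ) x y =
      ((α * c₁ + β * c₄ + γ * c₆) * D - (α * a + β * b + γ * d) *
        (c₁ * d + a * c₆ - 2 * b * c₄)) / D ^ 2 := by
  subst hDD ha hb hd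
  have h := quot_deriv α β γ c₁ (c₂ * y + c₃) c₄ (c₁ * y + c₅) c₆ (c₄ * y + c₇) x
    (by simpa only [← add_assoc] using hD)
  simp only [← add_assoc] at h
  simpa only [pd, FF, if_true] using h

lemma pd_one_FF (c₁ c₂ c₃ c₄ c₅ c₆ c₇ α β γ x y a b d D : ℝ)
    (ha : a = c₁ * x + c₂ * y + c₃) (hb : b = c₄ * x + c₁ * y + c₅)
    (hd : d = c₆ * x + c₄ * y + c₇) (hDD : D = a * d - b ^ 2) (hD : D ≠ 0) :
    pd 1 (FF c₁ c₂ c₃ c₄ c₅ c₆ c₇ α β γ) x y =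
      ((α * c₂ + β * c₁ + γ * c₄) * D - (α * a + β * b + γ * d) *
        (c₂ * d + a * c₄ - 2 * b * c₁)) / D ^ 2 := by
  subst hDD ha hb hd
  have e : ∀ p q r s : ℝ, p * s + (q * x + r) = q * x + p * s + r := by intros; ring
  have h := quot_deriv α β γ c₂ (c₁ * x + c₃) c₁ (c₄ * x + c₅) c₄ (c₆ * x + c₇) y
    (by simpa only [e] using hD)
  simp only [e] at h
  simpa only [pd, FF, one_ne_zero, if_false] using h

/-- The metric. -/
def GG (c₁ c₂ c₃ c₄ c₅ c₆ c₇ : ℝ) : ℝ → ℝ → Matrix (Fin 2) (Fin 2) ℝ :=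
  fun a b => !![c₁ * a + c₂ * b + c₃, c₄ * a + c₁ * b + c₅;
          c₄ * a + c₁ * b + c₅, c₆ * a + c₄ * b + c₇]

/-- Coefficients of `g_{ij}`. -/
def KK (l k : Fin 2) : Fin 3 → ℝ :=
  (!![![0, 0, 1], ![0, -1, 0]; ![0, -1, 0], ![1, 0, 0]] : Matrix (Fin 2) (Fin 2) (Fin 3 → ℝ)) l k

lemma cov_GG (c₁ c₂ c₃ c₄ c₅ c₆ c₇ : ℝ) (l k : Fin 2) :
    covMetric (GG c₁ c₂ c₃ c₄ c₅ c₆ c₇) l k =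
      FF c₁ c₂ c₃ c₄ c₅ c₆ c₇ (KK l k 0) (KK l k 1) (KK l k 2) := by
  funext x y
  fin_cases l <;> fin_cases k <;>
    simp [covMetric, GG, FF, KK, Matrix.inv_def, Matrix.adjugate_fin_two, Matrix.det_fin_two] <;>
    ring

/-- Coefficients of the Christoffel symbols: `Γ^j_{lk} = -(1/2) g_{li} ∂_k g^{ij}`. -/
noncomputable def CC (c₁ c₂ c₄ c₆ : ℝ) (i j k : Fin 2) : Fin 3 → ℝ :=
  let da : Fin 2 → ℝ := ![c₁, c₂]
  let db : Fin 2 → ℝ := ![c₄, c₁]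
  let dd : Fin 2 → ℝ := ![c₆, c₄]
  (!![![0, db k / 2, - da k / 2], ![-db k / 2, da k / 2, 0];
    ![0, dd k / 2, - db k / 2], ![-dd k / 2, db k / 2, 0]] :
      Matrix (Fin 2) (Fin 2) (Fin 3 → ℝ)) i j

lemma chr_GG (c₁ c₂ c₃ c₄ c₅ c₆ c₇ : ℝ)
    (h1 : c₁ * c₄ - c₂ * c₆ = 0)
    (h2 : c₃ * c₄ - c₂ * c₇ = 0)
    (h3 : c₃ * c₆ - c₁ * c₇ = 0) (i j k : Fin 2) (x y : ℝ)
    (hD : (c₁ * x + c₂ * y + c₃) * (c₆ * x + c₄ * y + c₇) - (c₄ * x + c₁ * y + c₅) ^ 2 ≠ 0) :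
    christoffel (GG c₁ c₂ c₃ c₄ c₅ c₆ c₇) i j k x y =
      FF c₁ c₂ c₃ c₄ c₅ c₆ c₇ (CC c₁ c₂ c₄ c₆ i j k 0) (CC c₁ c₂ c₄ c₆ i j k 1)
        (CC c₁ c₂ c₄ c₆ i j k 2) x y := by
  obtain ⟨a, ha⟩ : ∃ a, a = c₁ * x + c₂ * y + c₃ := ⟨_, rfl⟩
  obtain ⟨b, hb⟩ : ∃ b, b = c₄ * x + c₁ * y + c₅ := ⟨_, rfl⟩
  obtain ⟨d, hd⟩ : ∃ d, d = c₆ * x + c₄ * y + c₇ := ⟨_, rfl⟩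
  have A : a * c₄ = c₂ * d := by rw [ha, hd]; linear_combination x * h1 + h2
  have B : a * c₆ = c₁ * d := by rw [ha, hd]; linear_combination -y * h1 + h3
  rw [← ha, ← hb, ← hd] at hD
  have p0 := fun α β γ => pd_zero_FF c₁ c₂ c₃ c₄ c₅ c₆ c₇ α β γ x y a b d _ ha hb hd rfl hD
  have p1 := fun α β γ => pd_one_FF c₁ c₂ c₃ c₄ c₅ c₆ c₇ α β γ x y a b d _ ha hb hd rfl hD
  simp only [christoffel, cov_GG, Fin.sum_univ_two]
  have g00 : GG c₁ c₂ c₃ c₄ c₅ c₆ c₇ x y 0 0 = a := by simp [GG, ha]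
  have g01 : GG c₁ c₂ c₃ c₄ c₅ c₆ c₇ x y 0 1 = b := by simp [GG, hb]
  have g10 : GG c₁ c₂ c₃ c₄ c₅ c₆ c₇ x y 1 0 = b := by simp [GG, hb]
  have g11 : GG c₁ c₂ c₃ c₄ c₅ c₆ c₇ x y 1 1 = d := by simp [GG, hd]
  clear h1 h2 h3
  fin_cases i <;> fin_cases j <;> fin_cases k <;>
    simp only [Fin.zero_eta, Fin.mk_one, Fin.isValue, p0, p1, g00, g01, g10, g11] <;>
    simp only [FF, ← ha, ← hb, ← hd] <;> simp [KK, CC] <;> clear p0 p1 g00 g01 g10 g11 ha hb hd <;>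
    field_simp <;> grind

lemma pd_congr_FF (c₁ c₂ c₃ c₄ c₅ c₆ c₇ α β γ x y : ℝ) (f : ℝ → ℝ → ℝ) (k : Fin 2)
    (hf : ∀ x y, (c₁ * x + c₂ * y + c₃) * (c₆ * x + c₄ * y + c₇) - (c₄ * x + c₁ * y + c₅) ^ 2 ≠ 0 →
      f x y = FF c₁ c₂ c₃ c₄ c₅ c₆ c₇ α β γ x y)
    (hD : (c₁ * x + c₂ * y + c₃) * (c₆ * x + c₄ * y + c₇) - (c₄ * x + c₁ * y + c₅) ^ 2 ≠ 0) :
    pd k f x y = pd k (FF c₁ c₂ c₃ c₄ c₅ c₆ c₇ α β γ) x y := by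
  have e0 : ∀ᶠ s in nhds x, (c₁ * s + c₂ * y + c₃) * (c₆ * s + c₄ * y + c₇)
      - (c₄ * s + c₁ * y + c₅) ^ 2 ≠ 0 :=
    ContinuousAt.eventually_ne (by fun_prop) hD
  have e1 : ∀ᶠ s in nhds y, (c₁ * x + c₂ * s + c₃) * (c₆ * x + c₄ * s + c₇)
      - (c₄ * x + c₁ * s + c₅) ^ 2 ≠ 0 :=
    ContinuousAt.eventually_ne (by fun_prop) hD
  unfold pd
  split_ifs
  · exact Filter.EventuallyEq.deriv_eq (e0.mono fun s hs => hf s y hs)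
  · exact Filter.EventuallyEq.deriv_eq (e1.mono fun s hs => hf x s hs)

set_option maxHeartbeats 4000000 in
/-- **Theorem 2 of the paper (flatness part).** If the parameters `c₁,…,c₇`
satisfy the Levi-Civita conditions (eq:165), then the contravariant metric
`g¹¹ = c₁u¹ + c₂u² + c₃`, `g¹² = g²¹ = c₄u¹ + c₁u² + c₅`,
`g²² = c₆u¹ + c₄u² + c₇` is flat at every point where it is non-degenerate. -/
theorem flat_R3_1_metric (c₁ c₂ c₃ c₄ c₅ c₆ c₇ : ℝ)
    (h1 : c₁ * c₄ - c₂ * c₆ = 0)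
    (h2 : c₃ * c₄ - c₂ * c₇ = 0)
    (h3 : c₃ * c₆ - c₁ * c₇ = 0) :
    ∀ x y : ℝ,
      Matrix.det (!![c₁ * x + c₂ * y + c₃, c₄ * x + c₁ * y + c₅;
        c₄ * x + c₁ * y + c₅, c₆ * x + c₄ * y + c₇]) ≠ 0 →
      ∀ i j k l : Fin 2,
        riemann (fun a b => !![c₁ * a + c₂ * b + c₃, c₄ * a + c₁ * b + c₅;
          c₄ * a + c₁ * b + c₅, c₆ * a + c₄ * b + c₇]) i j k l x y = 0 := by
  intro x y hdet i j k l
  change riemann (GG c₁ c₂ c₃ c₄ c₅ c₆ c₇) i j k l x y = 0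
  have hD : (c₁ * x + c₂ * y + c₃) * (c₆ * x + c₄ * y + c₇) - (c₄ * x + c₁ * y + c₅) ^ 2 ≠ 0 := by
    rw [Matrix.det_fin_two_of] at hdet
    rwa [pow_two]
  have hc := fun i j k => chr_GG c₁ c₂ c₃ c₄ c₅ c₆ c₇ h1 h2 h3 i j k
  have hp := fun i j k m => pd_congr_FF c₁ c₂ c₃ c₄ c₅ c₆ c₇ _ _ _ x y _ m (hc i j k) hD
  have hcv := fun i j k => hc i j k x y hD
  simp only [riemann, hp, hcv, Fin.sum_univ_two]
  clear hp hcv hc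
  obtain ⟨a, ha⟩ : ∃ a, a = c₁ * x + c₂ * y + c₃ := ⟨_, rfl⟩
  obtain ⟨b, hb⟩ : ∃ b, b = c₄ * x + c₁ * y + c₅ := ⟨_, rfl⟩
  obtain ⟨d, hd⟩ : ∃ d, d = c₆ * x + c₄ * y + c₇ := ⟨_, rfl⟩
  have A : a * c₄ = c₂ * d := by rw [ha, hd]; linear_combination x * h1 + h2
  have B : a * c₆ = c₁ * d := by rw [ha, hd]; linear_combination -y * h1 + h3
  have C : c₁ * c₄ = c₂ * c₆ := by linear_combination h1
  rw [← ha, ← hb, ← hd] at hD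
  have p0 := fun α β γ => pd_zero_FF c₁ c₂ c₃ c₄ c₅ c₆ c₇ α β γ x y a b d _ ha hb hd rfl hD
  have p1 := fun α β γ => pd_one_FF c₁ c₂ c₃ c₄ c₅ c₆ c₇ α β γ x y a b d _ ha hb hd rfl hD
  clear h1 h2 h3 hdet
  fin_cases k <;> fin_cases l <;>
    fin_cases i <;> fin_cases j <;>
    simp only [Fin.zero_eta, Fin.mk_one, Fin.isValue, p0, p1] <;>
    simp only [FF, ← ha, ← hb, ← hd] <;> simp [CC] <;> clear p0 p1 ha hb hd <;>
    field_simp <;> grind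
end

section
/- Let (c₁,…,c₆) ∈ ℝ⁶ satisfy c₂c₆ + 2c₁c₃ = 0, c₂c₅ = 0 and c₁c₅ = 0. Then the contravariant metric on ℝ² (coordinates u¹,u²) with components g¹¹ = c₁u¹ + c₂u², g¹² = g²¹ = c₄u¹ + c₃/u¹ + c₂(u²)²/(2u¹), g²² = 2c₄u² + c₆/u¹ − c₁(u²)²/u¹ + c₅ is flat on the open set where u¹ ≠ 0 and det(g^{ij}) ≠ 0. -/
open Matrix

section helpers

/-- Covariant components of a generic symmetric 2×2 metric. -/
lemma cov_formula (A B C : ℝ → ℝ → ℝ) (x y : ℝ) :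
    covMetric (fun a b => !![A a b, B a b; B a b, C a b]) 0 0 x y
        = C x y / (A x y * C x y - B x y ^ 2) ∧
    covMetric (fun a b => !![A a b, B a b; B a b, C a b]) 0 1 x y
        = - B x y / (A x y * C x y - B x y ^ 2) ∧
    covMetric (fun a b => !![A a b, B a b; B a b, C a b]) 1 0 x y
        = - B x y / (A x y * C x y - B x y ^ 2) ∧
    covMetric (fun a b => !![A a b, B a b; B a b, C a b]) 1 1 x y
        = A x y / (A x y * C x y - B x y ^ 2) := by
  refine ⟨?_, ?_, ?_, ?_⟩ <;>
  · simp [covMetric, Matrix.inv_def, Matrix.adjugate_fin_two, Matrix.det_fin_two, div_eq_inv_mul,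
      pow_two]

/-- Derivative of `N / (A C - B^2)`. -/
lemma deriv_quot {a b c n : ℝ → ℝ} {a' b' c' n' t : ℝ} (ha : HasDerivAt a a' t)
    (hb : HasDerivAt b b' t) (hc : HasDerivAt c c' t) (hn : HasDerivAt n n' t)
    (h : a t * c t - b t ^ 2 ≠ 0) :
    deriv (fun s => n s / (a s * c s - b s ^ 2)) t
      = (n' * (a t * c t - b t ^ 2) - n t * (a' * c t + a t * c' - 2 * b t * b'))
        / (a t * c t - b t ^ 2) ^ 2 := by
  have h1 := (hn.div ((ha.mul hc).sub (hb.pow 2)) h).deriv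
  have h2 : deriv (fun s => n s / (a s * c s - b s ^ 2)) t = _ := h1
  rw [h2]
  simp

/-- The explicit expression for the Christoffel symbols in terms of contravariant ones
`p i k = Γ^{1i}_k`, `q i k = Γ^{2i}_k`. -/
noncomputable def gam (A B C p q : ℝ) (j : Fin 2) : ℝ :=
  (if j = 0 then -(C * p - B * q) else -(A * q - B * p)) / (A * C - B ^ 2)

lemma christoffel_formula (A B C : ℝ → ℝ → ℝ) (x y : ℝ)
    (P Q : Fin 2 → Fin 2 → ℝ)
    (hA0 : HasDerivAt (fun s => A s y) (2 * P 0 0) x)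
    (hA1 : HasDerivAt (fun s => A x s) (2 * P 0 1) y)
    (hB0 : HasDerivAt (fun s => B s y) (P 1 0 + Q 0 0) x)
    (hB1 : HasDerivAt (fun s => B x s) (P 1 1 + Q 0 1) y)
    (hC0 : HasDerivAt (fun s => C s y) (2 * Q 1 0) x)
    (hC1 : HasDerivAt (fun s => C x s) (2 * Q 1 1) y)
    (S1 : A x y * Q 0 0 + B x y * Q 0 1 = B x y * P 0 0 + C x y * P 0 1)
    (S2 : A x y * Q 1 0 + B x y * Q 1 1 = B x y * P 1 0 + C x y * P 1 1)
    (h : A x y * C x y - B x y ^ 2 ≠ 0) (i j k : Fin 2) :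
    christoffel (fun a b => !![A a b, B a b; B a b, C a b]) i j k x y
      = gam (A x y) (B x y) (C x y) (P i k) (Q i k) j := by
  have e00 := fun x y => (cov_formula A B C x y).1
  have e01 := fun x y => (cov_formula A B C x y).2.1
  have e10 := fun x y => (cov_formula A B C x y).2.2.1
  have e11 := fun x y => (cov_formula A B C x y).2.2.2
  have dA0 := deriv_quot hA0 hB0 hC0 hA0 h
  have dA1 := deriv_quot hA1 hB1 hC1 hA1 h
  have dB0 := deriv_quot hA0 hB0 hC0 hB0.neg h
  have dB1 := deriv_quot hA1 hB1 hC1 hB1.neg h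
  have dC0 := deriv_quot hA0 hB0 hC0 hC0 h
  have dC1 := deriv_quot hA1 hB1 hC1 hC1 h
  simp only [Pi.neg_apply] at dB0 dB1
  fin_cases i <;> fin_cases j <;> fin_cases k <;>
  · simp [christoffel, pd, gam, Fin.sum_univ_two, e00, e01, e10, e11, dA0, dA1, dB0, dB1, dC0, dC1, -deriv_div_const]
    clear dA0 dA1 dB0 dB1 dC0 dC1 hA0 hA1 hB0 hB1 hC0 hC1 e00 e01 e10 e11
    generalize A x y = a at *
    generalize B x y = b at *
    generalize C x y = c at *
    generalize P 0 0 = p00 at *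
    generalize P 0 1 = p01 at *
    generalize P 1 0 = p10 at *
    generalize P 1 1 = p11 at *
    generalize Q 0 0 = q00 at *
    generalize Q 0 1 = q01 at *
    generalize Q 1 0 = q10 at *
    generalize Q 1 1 = q11 at *
    field_simp
    grind

lemma christoffel_symm (A B C : ℝ → ℝ → ℝ) (i j k : Fin 2) :
    christoffel (fun a b => !![A a b, B a b; B a b, C a b]) i j k
      = christoffel (fun a b => !![A a b, B a b; B a b, C a b]) i k j := by
  have e : covMetric (fun a b => !![A a b, B a b; B a b, C a b]) 0 1
      = covMetric (fun a b => !![A a b, B a b; B a b, C a b]) 1 0 := by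
    funext x y
    rw [(cov_formula A B C x y).2.1, (cov_formula A B C x y).2.2.1]
  funext x y
  fin_cases j <;> fin_cases k <;> simp [christoffel, Fin.sum_univ_two, e, add_comm]

/-- Numerator of the derivative of `gam`. -/
noncomputable def dgam (A B C p q A' B' C' p' q' : ℝ) (j : Fin 2) : ℝ :=
  ((if j = 0 then -(C' * p + C * p' - (B' * q + B * q'))
      else -(A' * q + A * q' - (B' * p + B * p'))) * (A * C - B ^ 2)
    - (if j = 0 then -(C * p - B * q) else -(A * q - B * p))
      * (A' * C + A * C' - 2 * B * B')) / (A * C - B ^ 2) ^ 2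

lemma deriv_gam {a b c p q : ℝ → ℝ} {a' b' c' p' q' t : ℝ} (ha : HasDerivAt a a' t)
    (hb : HasDerivAt b b' t) (hc : HasDerivAt c c' t) (hp : HasDerivAt p p' t)
    (hq : HasDerivAt q q' t) (h : a t * c t - b t ^ 2 ≠ 0) (j : Fin 2) :
    deriv (fun s => gam (a s) (b s) (c s) (p s) (q s) j) t
      = dgam (a t) (b t) (c t) (p t) (q t) a' b' c' p' q' j := by
  fin_cases j
  · simpa [gam, dgam] using deriv_quot ha hb hc ((hc.mul hp).sub (hb.mul hq)).neg h
  · simpa [gam, dgam] using deriv_quot ha hb hc ((ha.mul hq).sub (hb.mul hp)).neg h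

/-- `g¹¹`. -/
noncomputable def mA (c₁ c₂ : ℝ) (a b : ℝ) : ℝ := c₁ * a + c₂ * b
/-- `g¹²`. -/
noncomputable def mB (c₂ c₃ c₄ : ℝ) (a b : ℝ) : ℝ := c₄ * a + c₃ / a + c₂ * b ^ 2 / (2 * a)
/-- `g²²`. -/
noncomputable def mC (c₁ c₄ c₅ c₆ : ℝ) (a b : ℝ) : ℝ :=
  2 * c₄ * b + c₆ / a - c₁ * b ^ 2 / a + c₅
/-- Contravariant Christoffel symbols `Γ^{1i}_k`. -/
noncomputable def mP (c₁ c₂ c₄ : ℝ) (i k : Fin 2) : ℝ :=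
  if i = 0 then (if k = 0 then c₁ / 2 else c₂ / 2)
  else (if k = 0 then c₄ else - c₁ / 2)
/-- Contravariant Christoffel symbols `Γ^{2i}_k`. -/
noncomputable def mQ (c₁ c₂ c₃ c₄ c₆ : ℝ) (a b : ℝ) (i k : Fin 2) : ℝ :=
  if i = 0 then
    (if k = 0 then - c₃ / a ^ 2 - c₂ * b ^ 2 / (2 * a ^ 2) else c₂ * b / a + c₁ / 2)
  else (if k = 0 then (- c₆ / a ^ 2 + c₁ * b ^ 2 / a ^ 2) / 2 else c₄ - c₁ * b / a)

/-- `∂_k Γ^{2i}_l`; the first index is the direction. -/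
noncomputable def dQ (c₁ c₂ c₃ c₆ : ℝ) (a b : ℝ) (k i l : Fin 2) : ℝ :=
  if i = 0 then
    if l = 0 then
      (if k = 0 then 2 * c₃ / a ^ 3 + c₂ * b ^ 2 / a ^ 3 else - c₂ * b / a ^ 2)
    else (if k = 0 then - c₂ * b / a ^ 2 else c₂ / a)
  else if l = 0 then
    (if k = 0 then c₆ / a ^ 3 - c₁ * b ^ 2 / a ^ 3 else c₁ * b / a ^ 2)
  else (if k = 0 then c₁ * b / a ^ 2 else - c₁ / a)

lemma hd_const_div (c t : ℝ) (n : ℕ) (ht : t ≠ 0) :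
    HasDerivAt (fun s : ℝ => c / s ^ (n + 1)) (-(c * (n + 1)) / t ^ (n + 2)) t := by
  have := (hasDerivAt_const t c).div (hasDerivAt_pow (n + 1) t) (pow_ne_zero _ ht)
  refine this.congr_deriv ?_
  simp
  field_simp
  ring

lemma hd_quad (α β γ t : ℝ) :
    HasDerivAt (fun s : ℝ => α * s ^ 2 + β * s + γ) (2 * α * t + β) t := by
  have := (((hasDerivAt_pow 2 t).const_mul α).add ((hasDerivAt_id t).const_mul β)).add_const γ
  refine this.congr_deriv ?_
  simp
  ring

lemma hd_laurent (α β γ δ t : ℝ) (ht : t ≠ 0) :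
    HasDerivAt (fun s : ℝ => α * s + β + γ / s + δ / s ^ 2)
      (α - γ / t ^ 2 - 2 * δ / t ^ 3) t := by
  have h1 := hd_const_div γ t 0 ht
  have h2 := hd_const_div δ t 1 ht
  have h0 := ((hasDerivAt_id t).const_mul α).add_const β
  have := (h0.add h1).add h2
  refine HasDerivAt.congr_deriv (this.congr_of_eventuallyEq ?_) ?_
  · refine Filter.Eventually.of_forall fun s => ?_
    simp
  · simp
    ring

section derivs
variable (c₁ c₂ c₃ c₄ c₅ c₆ x y : ℝ)

lemma mA_x : HasDerivAt (fun s => mA c₁ c₂ s y) (2 * mP c₁ c₂ c₄ 0 0) x := by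
  have := hd_quad 0 c₁ (c₂ * y) x
  refine HasDerivAt.congr_deriv (this.congr_of_eventuallyEq (.of_forall fun s => ?_)) ?_
  · simp [mA]
  · simp [mP]; ring

lemma mA_y : HasDerivAt (fun s => mA c₁ c₂ x s) (2 * mP c₁ c₂ c₄ 0 1) y := by
  have := hd_quad 0 c₂ (c₁ * x) y
  refine HasDerivAt.congr_deriv (this.congr_of_eventuallyEq (.of_forall fun s => ?_)) ?_
  · simp [mA]; ring
  · simp [mP]; ring

lemma mB_x (hx : x ≠ 0) : HasDerivAt (fun s => mB c₂ c₃ c₄ s y)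
    (mP c₁ c₂ c₄ 1 0 + mQ c₁ c₂ c₃ c₄ c₆ x y 0 0) x := by
  have := hd_laurent c₄ 0 (c₃ + c₂ * y ^ 2 / 2) 0 x hx
  refine HasDerivAt.congr_deriv (this.congr_of_eventuallyEq (.of_forall fun s => ?_)) ?_
  · simp [mB]; ring
  · simp [mP, mQ]; ring

lemma mB_y : HasDerivAt (fun s => mB c₂ c₃ c₄ x s)
    (mP c₁ c₂ c₄ 1 1 + mQ c₁ c₂ c₃ c₄ c₆ x y 0 1) y := by
  have := hd_quad (c₂ / (2 * x)) 0 (c₄ * x + c₃ / x) y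
  refine HasDerivAt.congr_deriv (this.congr_of_eventuallyEq (.of_forall fun s => ?_)) ?_
  · simp [mB]; ring
  · simp [mP, mQ]; ring

lemma mC_x (hx : x ≠ 0) : HasDerivAt (fun s => mC c₁ c₄ c₅ c₆ s y)
    (2 * mQ c₁ c₂ c₃ c₄ c₆ x y 1 0) x := by
  have := hd_laurent 0 (2 * c₄ * y + c₅) (c₆ - c₁ * y ^ 2) 0 x hx
  refine HasDerivAt.congr_deriv (this.congr_of_eventuallyEq (.of_forall fun s => ?_)) ?_
  · simp [mC]; ring
  · simp [mQ]; ring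

lemma mC_y : HasDerivAt (fun s => mC c₁ c₄ c₅ c₆ x s) (2 * mQ c₁ c₂ c₃ c₄ c₆ x y 1 1) y := by
  have := hd_quad (-c₁ / x) (2 * c₄) (c₆ / x + c₅) y
  refine HasDerivAt.congr_deriv (this.congr_of_eventuallyEq (.of_forall fun s => ?_)) ?_
  · simp [mC]; ring
  · simp [mQ]; ring

lemma mQ_x (hx : x ≠ 0) (i l : Fin 2) :
    HasDerivAt (fun s => mQ c₁ c₂ c₃ c₄ c₆ s y i l) (dQ c₁ c₂ c₃ c₆ x y 0 i l) x := by
  fin_cases i <;> fin_cases l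
  · have := hd_laurent 0 0 0 (-c₃ - c₂ * y ^ 2 / 2) x hx
    refine HasDerivAt.congr_deriv (this.congr_of_eventuallyEq (.of_forall fun s => ?_)) ?_
    · simp [mQ]; ring
    · simp [dQ]; ring
  · have := hd_laurent 0 (c₁ / 2) (c₂ * y) 0 x hx
    refine HasDerivAt.congr_deriv (this.congr_of_eventuallyEq (.of_forall fun s => ?_)) ?_
    · simp [mQ]; ring
    · simp [dQ]; ring
  · have := hd_laurent 0 0 0 ((-c₆ + c₁ * y ^ 2) / 2) x hx
    refine HasDerivAt.congr_deriv (this.congr_of_eventuallyEq (.of_forall fun s => ?_)) ?_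
    · simp [mQ]; ring
    · simp [dQ]; ring
  · have := hd_laurent 0 c₄ (-c₁ * y) 0 x hx
    refine HasDerivAt.congr_deriv (this.congr_of_eventuallyEq (.of_forall fun s => ?_)) ?_
    · simp [mQ]; ring
    · simp [dQ]; ring

lemma mQ_y (i l : Fin 2) :
    HasDerivAt (fun s => mQ c₁ c₂ c₃ c₄ c₆ x s i l) (dQ c₁ c₂ c₃ c₆ x y 1 i l) y := by
  fin_cases i <;> fin_cases l
  · have := hd_quad (-c₂ / (2 * x ^ 2)) 0 (-c₃ / x ^ 2) y
    refine HasDerivAt.congr_deriv (this.congr_of_eventuallyEq (.of_forall fun s => ?_)) ?_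
    · simp [mQ]; ring
    · simp [dQ]; ring
  · have := hd_quad 0 (c₂ / x) (c₁ / 2) y
    refine HasDerivAt.congr_deriv (this.congr_of_eventuallyEq (.of_forall fun s => ?_)) ?_
    · simp [mQ]; ring
    · simp [dQ]
  · have := hd_quad (c₁ / (2 * x ^ 2)) 0 (-c₆ / (2 * x ^ 2)) y
    refine HasDerivAt.congr_deriv (this.congr_of_eventuallyEq (.of_forall fun s => ?_)) ?_
    · simp [mQ]; ring
    · simp [dQ]; ring
  · have := hd_quad 0 (-c₁ / x) c₄ y
    refine HasDerivAt.congr_deriv (this.congr_of_eventuallyEq (.of_forall fun s => ?_)) ?_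
    · simp [mQ]; ring
    · simp [dQ]

end derivs

lemma symm_one (c₁ c₂ c₃ c₄ c₅ c₆ : ℝ) (h1 : c₂ * c₆ + 2 * c₁ * c₃ = 0) (h2 : c₂ * c₅ = 0)
    (x y : ℝ) (hx : x ≠ 0) : mA c₁ c₂ x y * mQ c₁ c₂ c₃ c₄ c₆ x y 0 0
      + mB c₂ c₃ c₄ x y * mQ c₁ c₂ c₃ c₄ c₆ x y 0 1
    = mB c₂ c₃ c₄ x y * mP c₁ c₂ c₄ 0 0 + mC c₁ c₄ c₅ c₆ x y * mP c₁ c₂ c₄ 0 1 := by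
  simp [mA, mB, mC, mP, mQ]
  field_simp
  grind

lemma symm_two (c₁ c₂ c₃ c₄ c₅ c₆ : ℝ) (h1 : c₂ * c₆ + 2 * c₁ * c₃ = 0) (h3 : c₁ * c₅ = 0)
    (x y : ℝ) (hx : x ≠ 0) : mA c₁ c₂ x y * mQ c₁ c₂ c₃ c₄ c₆ x y 1 0
      + mB c₂ c₃ c₄ x y * mQ c₁ c₂ c₃ c₄ c₆ x y 1 1
    = mB c₂ c₃ c₄ x y * mP c₁ c₂ c₄ 1 0 + mC c₁ c₄ c₅ c₆ x y * mP c₁ c₂ c₄ 1 1 := by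
  simp [mA, mB, mC, mP, mQ]
  field_simp
  grind

lemma quad_rel_one (c₁ c₂ c₃ c₄ c₆ : ℝ) (h1 : c₂ * c₆ + 2 * c₁ * c₃ = 0)
    (x y : ℝ) (hx : x ≠ 0) (l : Fin 2) :
    mP c₁ c₂ c₄ 0 0 * mP c₁ c₂ c₄ 1 l + mP c₁ c₂ c₄ 0 1 * mQ c₁ c₂ c₃ c₄ c₆ x y 1 l
    = mP c₁ c₂ c₄ 1 0 * mP c₁ c₂ c₄ 0 l + mP c₁ c₂ c₄ 1 1 * mQ c₁ c₂ c₃ c₄ c₆ x y 0 l := by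
  fin_cases l <;>
  · simp [mP, mQ]
    field_simp
    grind

lemma quad_rel_two (c₁ c₂ c₃ c₄ c₆ : ℝ) (h1 : c₂ * c₆ + 2 * c₁ * c₃ = 0)
    (x y : ℝ) (hx : x ≠ 0) (l : Fin 2) :
    mQ c₁ c₂ c₃ c₄ c₆ x y 0 0 * mP c₁ c₂ c₄ 1 l
      + mQ c₁ c₂ c₃ c₄ c₆ x y 0 1 * mQ c₁ c₂ c₃ c₄ c₆ x y 1 l
    = mQ c₁ c₂ c₃ c₄ c₆ x y 1 0 * mP c₁ c₂ c₄ 0 l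
      + mQ c₁ c₂ c₃ c₄ c₆ x y 1 1 * mQ c₁ c₂ c₃ c₄ c₆ x y 0 l := by
  fin_cases l <;>
  · simp [mP, mQ]
    field_simp
    grind

/-- The Christoffel symbols of the metric of the theorem. -/
lemma chr_metric (c₁ c₂ c₃ c₄ c₅ c₆ : ℝ)
    (h1 : c₂ * c₆ + 2 * c₁ * c₃ = 0) (h2 : c₂ * c₅ = 0) (h3 : c₁ * c₅ = 0)
    (x y : ℝ) (hx : x ≠ 0)
    (h : mA c₁ c₂ x y * mC c₁ c₄ c₅ c₆ x y - mB c₂ c₃ c₄ x y ^ 2 ≠ 0) (i j k : Fin 2) :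
    christoffel (fun a b => !![mA c₁ c₂ a b, mB c₂ c₃ c₄ a b;
        mB c₂ c₃ c₄ a b, mC c₁ c₄ c₅ c₆ a b]) i j k x y
      = gam (mA c₁ c₂ x y) (mB c₂ c₃ c₄ x y) (mC c₁ c₄ c₅ c₆ x y)
          (mP c₁ c₂ c₄ i k) (mQ c₁ c₂ c₃ c₄ c₆ x y i k) j := by
  refine christoffel_formula (mA c₁ c₂) (mB c₂ c₃ c₄) (mC c₁ c₄ c₅ c₆) x y
    (mP c₁ c₂ c₄) (mQ c₁ c₂ c₃ c₄ c₆ x y) (mA_x ..) (mA_y ..) (mB_x (hx := hx) ..) (mB_y ..)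
    (mC_x (hx := hx) ..) (mC_y ..) ?_ ?_ h i j k
  · exact symm_one _ _ _ _ _ _ h1 h2 _ _ hx
  · exact symm_two _ _ _ _ _ _ h1 h3 _ _ hx

/-- The algebraic identity behind flatness: the contravariant symbols are closed and satisfy
quadratic relations. -/
lemma flat_alg (A B C : ℝ) (P Q dX dY : Fin 2 → Fin 2 → ℝ)
    (S1 : A * Q 0 0 + B * Q 0 1 = B * P 0 0 + C * P 0 1)
    (S2 : A * Q 1 0 + B * Q 1 1 = B * P 1 0 + C * P 1 1)
    (F1 : ∀ l, P 0 0 * P 1 l + P 0 1 * Q 1 l = P 1 0 * P 0 l + P 1 1 * Q 0 l)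
    (F2 : ∀ l, Q 0 0 * P 1 l + Q 0 1 * Q 1 l = Q 1 0 * P 0 l + Q 1 1 * Q 0 l)
    (hd : ∀ i, dX i 1 = dY i 0)
    (h : A * C - B ^ 2 ≠ 0) (i j : Fin 2) :
    dgam A B C (P i 1) (Q i 1) (2 * P 0 0) (P 1 0 + Q 0 0) (2 * Q 1 0) 0 (dX i 1) j
      - dgam A B C (P i 0) (Q i 0) (2 * P 0 1) (P 1 1 + Q 0 1) (2 * Q 1 1) 0 (dY i 0) j
      + ∑ m, (gam A B C (P i 0) (Q i 0) m * gam A B C (P m 1) (Q m 1) j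
          - gam A B C (P i 1) (Q i 1) m * gam A B C (P m 0) (Q m 0) j) = 0 := by
  have F10 := F1 0
  have F11 := F1 1
  have F20 := F2 0
  have F21 := F2 1
  rw [hd]
  clear F1 F2 hd
  generalize dY i 0 = d
  fin_cases i <;> fin_cases j <;>
  · simp [gam, dgam, Fin.sum_univ_two]
    generalize P 0 0 = p00 at *
    generalize P 0 1 = p01 at *
    generalize P 1 0 = p10 at *
    generalize P 1 1 = p11 at *
    generalize Q 0 0 = q00 at *
    generalize Q 0 1 = q01 at *
    generalize Q 1 0 = q10 at *
    generalize Q 1 1 = q11 at *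
    field_simp
    grind

lemma gam_event {a b c p q f : ℝ → ℝ} {t : ℝ} {j : Fin 2}
    (h : ∀ᶠ s in nhds t, f s = gam (a s) (b s) (c s) (p s) (q s) j) :
    deriv f t = deriv (fun s => gam (a s) (b s) (c s) (p s) (q s) j) t :=
  Filter.EventuallyEq.deriv_eq h

end helpers

/-- **Theorem 3 of the paper (flatness part).** If the parameters `c₁,…,c₆`
satisfy the Levi-Civita conditions (eq:17), then the contravariant metric
`g¹¹ = c₁u¹ + c₂u²`, `g¹² = g²¹ = c₄u¹ + c₃/u¹ + c₂(u²)²/(2u¹)`,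
`g²² = 2c₄u² + c₆/u¹ − c₁(u²)²/u¹ + c₅` is flat at every point where `u¹ ≠ 0`
and the metric is non-degenerate. -/
theorem flat_R3_2_metric (c₁ c₂ c₃ c₄ c₅ c₆ : ℝ)
    (h1 : c₂ * c₆ + 2 * c₁ * c₃ = 0)
    (h2 : c₂ * c₅ = 0)
    (h3 : c₁ * c₅ = 0) :
    ∀ x y : ℝ, x ≠ 0 →
      Matrix.det (!![c₁ * x + c₂ * y, c₄ * x + c₃ / x + c₂ * y ^ 2 / (2 * x);
        c₄ * x + c₃ / x + c₂ * y ^ 2 / (2 * x),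
        2 * c₄ * y + c₆ / x - c₁ * y ^ 2 / x + c₅]) ≠ 0 →
      ∀ i j k l : Fin 2,
        riemann (fun a b => !![c₁ * a + c₂ * b, c₄ * a + c₃ / a + c₂ * b ^ 2 / (2 * a);
          c₄ * a + c₃ / a + c₂ * b ^ 2 / (2 * a),
          2 * c₄ * b + c₆ / a - c₁ * b ^ 2 / a + c₅]) i j k l x y = 0 := by
  intro x y hx hdet i j k l
  have h : mA c₁ c₂ x y * mC c₁ c₄ c₅ c₆ x y - mB c₂ c₃ c₄ x y ^ 2 ≠ 0 := by
    rw [Matrix.det_fin_two] at hdet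
    simpa [mA, mB, mC, pow_two] using hdet
  change riemann (fun a b => !![mA c₁ c₂ a b, mB c₂ c₃ c₄ a b;
    mB c₂ c₃ c₄ a b, mC c₁ c₄ c₅ c₆ a b]) i j k l x y = 0
  have hchr := chr_metric c₁ c₂ c₃ c₄ c₅ c₆ h1 h2 h3
  have hsym := christoffel_symm (mA c₁ c₂) (mB c₂ c₃ c₄) (mC c₁ c₄ c₅ c₆)
  have hAx := mA_x c₁ c₂ c₄ x y
  have hAy := mA_y c₁ c₂ c₄ x y
  have hBx := mB_x c₁ c₂ c₃ c₄ c₆ x y hx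
  have hBy := mB_y c₁ c₂ c₃ c₄ c₆ x y
  have hCx := mC_x c₁ c₂ c₃ c₄ c₅ c₆ x y hx
  have hCy := mC_y c₁ c₂ c₃ c₄ c₅ c₆ x y
  -- derivatives of the Christoffel symbols
  have hdx : ∀ i j k, pd 0 (christoffel (fun a b => !![mA c₁ c₂ a b, mB c₂ c₃ c₄ a b;
      mB c₂ c₃ c₄ a b, mC c₁ c₄ c₅ c₆ a b]) i j k) x y
      = dgam (mA c₁ c₂ x y) (mB c₂ c₃ c₄ x y) (mC c₁ c₄ c₅ c₆ x y)
        (mP c₁ c₂ c₄ i k) (mQ c₁ c₂ c₃ c₄ c₆ x y i k)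
        (2 * mP c₁ c₂ c₄ 0 0) (mP c₁ c₂ c₄ 1 0 + mQ c₁ c₂ c₃ c₄ c₆ x y 0 0)
        (2 * mQ c₁ c₂ c₃ c₄ c₆ x y 1 0) 0 (dQ c₁ c₂ c₃ c₆ x y 0 i k) j := by
    intro i j k
    have hne : ∀ᶠ s in nhds x, s ≠ 0 ∧
        mA c₁ c₂ s y * mC c₁ c₄ c₅ c₆ s y - mB c₂ c₃ c₄ s y ^ 2 ≠ 0 :=
      (continuousAt_id.eventually_ne hx).and
        (((hAx.continuousAt.mul hCx.continuousAt).sub (hBx.continuousAt.pow 2)).eventually_ne h)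
    have e := gam_event (hne.mono fun s hs => hchr s y hs.1 hs.2 i j k)
    rw [pd, if_pos rfl, e]
    exact deriv_gam hAx hBx hCx (hasDerivAt_const x _) (mQ_x (hx := hx) ..) h j
  have hdy : ∀ i j k, pd 1 (christoffel (fun a b => !![mA c₁ c₂ a b, mB c₂ c₃ c₄ a b;
      mB c₂ c₃ c₄ a b, mC c₁ c₄ c₅ c₆ a b]) i j k) x y
      = dgam (mA c₁ c₂ x y) (mB c₂ c₃ c₄ x y) (mC c₁ c₄ c₅ c₆ x y)
        (mP c₁ c₂ c₄ i k) (mQ c₁ c₂ c₃ c₄ c₆ x y i k)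
        (2 * mP c₁ c₂ c₄ 0 1) (mP c₁ c₂ c₄ 1 1 + mQ c₁ c₂ c₃ c₄ c₆ x y 0 1)
        (2 * mQ c₁ c₂ c₃ c₄ c₆ x y 1 1) 0 (dQ c₁ c₂ c₃ c₆ x y 1 i k) j := by
    intro i j k
    have hne : ∀ᶠ s in nhds y,
        mA c₁ c₂ x s * mC c₁ c₄ c₅ c₆ x s - mB c₂ c₃ c₄ x s ^ 2 ≠ 0 :=
      ((hAy.continuousAt.mul hCy.continuousAt).sub (hBy.continuousAt.pow 2)).eventually_ne h
    have e := gam_event (hne.mono fun s hs => hchr x s hx hs i j k)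
    rw [pd, if_neg one_ne_zero, e]
    exact deriv_gam hAy hBy hCy (hasDerivAt_const y _) (mQ_y ..) h j
  have key : riemann (fun a b => !![mA c₁ c₂ a b, mB c₂ c₃ c₄ a b;
      mB c₂ c₃ c₄ a b, mC c₁ c₄ c₅ c₆ a b]) i j 0 1 x y = 0 := by
    have := flat_alg (mA c₁ c₂ x y) (mB c₂ c₃ c₄ x y) (mC c₁ c₄ c₅ c₆ x y)
      (mP c₁ c₂ c₄) (mQ c₁ c₂ c₃ c₄ c₆ x y) (dQ c₁ c₂ c₃ c₆ x y 0) (dQ c₁ c₂ c₃ c₆ x y 1)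
      (symm_one _ _ _ _ _ _ h1 h2 _ _ hx) (symm_two _ _ _ _ _ _ h1 h3 _ _ hx)
      (quad_rel_one _ _ _ _ _ h1 _ _ hx) (quad_rel_two _ _ _ _ _ h1 _ _ hx)
      (by intro i; fin_cases i <;> simp [dQ]) h i j
    rw [← this, riemann, hsym i 1 j, hsym i 0 j, hdx, hdy]
    congr 1
    refine Finset.sum_congr rfl fun m _ => ?_
    rw [hsym i 0 m, hsym i 1 m, hsym m 1 j, hsym m 0 j]
    simp only [hchr x y hx h]
  have anti : ∀ k l, riemann (fun a b => !![mA c₁ c₂ a b, mB c₂ c₃ c₄ a b;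
      mB c₂ c₃ c₄ a b, mC c₁ c₄ c₅ c₆ a b]) i j k l x y
      = - riemann (fun a b => !![mA c₁ c₂ a b, mB c₂ c₃ c₄ a b;
      mB c₂ c₃ c₄ a b, mC c₁ c₄ c₅ c₆ a b]) i j l k x y := by
    intro k l
    simp only [riemann, Fin.sum_univ_two]
    ring
  fin_cases k <;> fin_cases l
  · have := anti 0 0
    simp only [Fin.zero_eta]
    linarith
  · exact key
  · have := anti 1 0
    rw [key, neg_zero] at this
    exact this
  · have := anti 1 1
    simp only [Fin.mk_one]
    linarith
end

section
/- Let (c₁,…,c₆) ∈ ℝ⁶ satisfy c₂c₅ + 2c₁c₃ = 0, c₂c₆ − 2c₃c₄ = 0 and c₁c₆ + c₄c₅ = 0. Then the contravariant metric on ℝ² (coordinates u¹,u²) with components g¹¹ = c₁u¹ + c₂u² + c₃, g¹² = g²¹ = c₄u¹ − c₂/(2u¹) + c₃u²/u¹ + c₂(u²)²/(2u¹), g²² = 2c₄u² + c₁/u¹ + c₅u²/u¹ − c₁(u²)²/u¹ + c₆ is flat on the open set where u¹ ≠ 0 and det(g^{ij}) ≠ 0. -/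
open Matrix

/-- Cofactor matrix entries of the contravariant metric. -/
noncomputable def cofM (A B C : ℝ → ℝ → ℝ) (i j : Fin 2) (x y : ℝ) : ℝ :=
  if i = 0 then (if j = 0 then C x y else -B x y) else (if j = 0 then -B x y else A x y)

/-- Christoffel symbols `Γ^i_{kj} = - g_{js} b^{si}_k` from contravariant ones. -/
noncomputable def gamM (A B C : ℝ → ℝ → ℝ) (b : Fin 2 → Fin 2 → Fin 2 → ℝ → ℝ → ℝ)
    (i k j : Fin 2) (x y : ℝ) : ℝ :=
  -(cofM A B C j 0 x y * b 0 i k x y + cofM A B C j 1 x y * b 1 i k x y)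
    / (A x y * C x y - B x y ^ 2)

theorem cov_eq (A B C : ℝ → ℝ → ℝ) (l k : Fin 2) (x y : ℝ) :
    covMetric (fun a b => !![A a b, B a b; B a b, C a b]) l k x y
      = cofM A B C l k x y / (A x y * C x y - B x y ^ 2) := by
  fin_cases l <;> fin_cases k <;>
    simp [covMetric, cofM, Matrix.inv_def, Matrix.adjugate_fin_two, Matrix.det_fin_two] <;> ring

theorem pd_zero (f : ℝ → ℝ → ℝ) (x y : ℝ) : pd 0 f x y = deriv (fun s => f s y) x := by
  simp [pd]

theorem pd_one (f : ℝ → ℝ → ℝ) (x y : ℝ) : pd 1 f x y = deriv (fun s => f x s) y := by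
  simp [pd]

theorem hda_congr {f g : ℝ → ℝ} {f' g' t : ℝ} (h : HasDerivAt f f' t) (hf : ∀ a, g a = f a)
    (hd : g' = f') : HasDerivAt g g' t := by
  have e : g = f := funext hf
  rw [e, hd]; exact h

/-- derivative of a cofactor over determinant, one-variable version -/
theorem cof_deriv (a b c : ℝ → ℝ) (a' b' c' t : ℝ) (ha : HasDerivAt a a' t)
    (hb : HasDerivAt b b' t) (hc : HasDerivAt c c' t) (n : ℝ → ℝ) (n' : ℝ)
    (hn : HasDerivAt n n' t) (hD : a t * c t - b t ^ 2 ≠ 0) :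
    HasDerivAt (fun s => n s / (a s * c s - b s ^ 2))
      ((n' * (a t * c t - b t ^ 2) - n t * (a' * c t + a t * c' - 2 * b t * b'))
        / (a t * c t - b t ^ 2) ^ 2) t := by
  have h := hn.fun_div ((ha.fun_mul hc).fun_sub (hb.fun_pow 2)) hD
  refine hda_congr h (fun _ => rfl) ?_
  simp

theorem chr_eq (A B C : ℝ → ℝ → ℝ) (b : Fin 2 → Fin 2 → Fin 2 → ℝ → ℝ → ℝ) (x y : ℝ)
    (hAx : HasDerivAt (fun s => A s y) (2 * b 0 0 0 x y) x)
    (hAy : HasDerivAt (fun s => A x s) (2 * b 0 0 1 x y) y)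
    (hBx : HasDerivAt (fun s => B s y) (b 0 1 0 x y + b 1 0 0 x y) x)
    (hBy : HasDerivAt (fun s => B x s) (b 0 1 1 x y + b 1 0 1 x y) y)
    (hCx : HasDerivAt (fun s => C s y) (2 * b 1 1 0 x y) x)
    (hCy : HasDerivAt (fun s => C x s) (2 * b 1 1 1 x y) y)
    (hD : A x y * C x y - B x y ^ 2 ≠ 0)
    (T1 : A x y * b 1 0 0 x y + B x y * b 1 0 1 x y
      = B x y * b 0 0 0 x y + C x y * b 0 0 1 x y)
    (T2 : A x y * b 1 1 0 x y + B x y * b 1 1 1 x y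
      = B x y * b 0 1 0 x y + C x y * b 0 1 1 x y) (i k j : Fin 2) :
    christoffel (fun a b => !![A a b, B a b; B a b, C a b]) i k j x y = gamM A B C b i k j x y := by
  have e : ∀ l k, covMetric (fun a b => !![A a b, B a b; B a b, C a b]) l k
      = fun x y => cofM A B C l k x y / (A x y * C x y - B x y ^ 2) := by
    intro l k; funext x y; exact cov_eq A B C l k x y
  have x00 := (cof_deriv _ _ _ _ _ _ x hAx hBx hCx _ _ hCx hD).deriv
  have x01 := (cof_deriv _ _ _ _ _ _ x hAx hBx hCx _ _ hBx.fun_neg hD).deriv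
  have x11 := (cof_deriv _ _ _ _ _ _ x hAx hBx hCx _ _ hAx hD).deriv
  have y00 := (cof_deriv _ _ _ _ _ _ y hAy hBy hCy _ _ hCy hD).deriv
  have y01 := (cof_deriv _ _ _ _ _ _ y hAy hBy hCy _ _ hBy.fun_neg hD).deriv
  have y11 := (cof_deriv _ _ _ _ _ _ y hAy hBy hCy _ _ hAy hD).deriv
  clear hAx hAy hBx hBy hCx hCy
  fin_cases i <;> fin_cases k <;> fin_cases j <;>
    simp only [christoffel, gamM, e, Fin.sum_univ_two, Fin.zero_eta, Fin.mk_one, pd_zero, pd_one,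
      cofM, if_true, one_ne_zero, if_false, x00, x01, x11, y00, y01, y11, Matrix.of_apply,
      Matrix.cons_val_zero, Matrix.cons_val_one, Matrix.cons_val', Matrix.cons_val_fin_one] <;>
    clear x00 x01 x11 y00 y01 y11 e <;>
    generalize A x y = A at * <;> generalize B x y = B at * <;> generalize C x y = C at * <;>
    generalize b 0 0 0 x y = b000 at * <;> generalize b 0 0 1 x y = b001 at * <;>
    generalize b 0 1 0 x y = b010 at * <;> generalize b 0 1 1 x y = b011 at * <;>
    generalize b 1 0 0 x y = b100 at * <;> generalize b 1 0 1 x y = b101 at * <;>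
    generalize b 1 1 0 x y = b110 at * <;> generalize b 1 1 1 x y = b111 at * <;>
    field_simp
  · linear_combination (2*B^2) * T2 - (2*B*C) * T1
  · linear_combination (-2*A*B) * T2 + (2*A*C) * T1
  · linear_combination (-2*A*B) * T2 + (2*B^2) * T1
  · linear_combination (2*A^2) * T2 - (2*A*B) * T1
  · linear_combination (2*B*C) * T2 - (2*C^2) * T1
  · linear_combination (-2*B^2) * T2 + (2*B*C) * T1
  · linear_combination (-2*A*C) * T2 + (2*B*C) * T1
  · linear_combination (2*A*B) * T2 - (2*B^2) * T1

theorem riem_zero (A B C : ℝ → ℝ → ℝ) (b : Fin 2 → Fin 2 → Fin 2 → ℝ → ℝ → ℝ) (x y : ℝ)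
    (d0 d1 : Fin 2 → Fin 2 → ℝ)
    (hAx : HasDerivAt (fun s => A s y) (2 * b 0 0 0 x y) x)
    (hAy : HasDerivAt (fun s => A x s) (2 * b 0 0 1 x y) y)
    (hBx : HasDerivAt (fun s => B s y) (b 0 1 0 x y + b 1 0 0 x y) x)
    (hBy : HasDerivAt (fun s => B x s) (b 0 1 1 x y + b 1 0 1 x y) y)
    (hCx : HasDerivAt (fun s => C s y) (2 * b 1 1 0 x y) x)
    (hCy : HasDerivAt (fun s => C x s) (2 * b 1 1 1 x y) y)
    (h0 : ∀ s i, HasDerivAt (fun t => b s i 1 t y) (d0 s i) x)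
    (h1 : ∀ s i, HasDerivAt (fun t => b s i 0 x t) (d1 s i) y)
    (hD : A x y * C x y - B x y ^ 2 ≠ 0)
    (g : ℝ → ℝ → Matrix (Fin 2) (Fin 2) ℝ)
    (hg : ∀ i k j, christoffel g i k j x y = gamM A B C b i k j x y)
    (hgx : ∀ i k j, ∀ᶠ s in nhds x, christoffel g i k j s y = gamM A B C b i k j s y)
    (hgy : ∀ i k j, ∀ᶠ s in nhds y, christoffel g i k j x s = gamM A B C b i k j x s)
    (hS : ∀ a i, (A x y * C x y - B x y ^ 2) * (d0 a i - d1 a i)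
      = C x y * (b 0 a 0 x y * b 0 i 1 x y - b 0 a 1 x y * b 0 i 0 x y)
      - B x y * (b 0 a 0 x y * b 1 i 1 x y - b 0 a 1 x y * b 1 i 0 x y)
      - B x y * (b 1 a 0 x y * b 0 i 1 x y - b 1 a 1 x y * b 0 i 0 x y)
      + A x y * (b 1 a 0 x y * b 1 i 1 x y - b 1 a 1 x y * b 1 i 0 x y)) (i j k l : Fin 2) :
    riemann g i j k l x y = 0 := by
  have key : ∀ i j, riemann g i j 0 1 x y = 0 := by
    intro i j
    have c0 : ∀ i j, ∃ n', HasDerivAt (fun s => cofM A B C j i s y) n' x ∧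
      n' = (if j = 0 then (if i = 0 then 2 * b 1 1 0 x y else -(b 0 1 0 x y + b 1 0 0 x y)) else
        (if i = 0 then -(b 0 1 0 x y + b 1 0 0 x y) else 2 * b 0 0 0 x y)) := by
      intro i j
      refine ⟨_, ?_, rfl⟩
      fin_cases i <;> fin_cases j <;> simp only [cofM, Fin.zero_eta, Fin.mk_one, if_true,
        one_ne_zero, if_false]
      exacts [hCx, hBx.fun_neg, hBx.fun_neg, hAx]
    have c1 : ∀ i j, ∃ n', HasDerivAt (fun s => cofM A B C j i x s) n' y ∧
      n' = (if j = 0 then (if i = 0 then 2 * b 1 1 1 x y else -(b 0 1 1 x y + b 1 0 1 x y)) else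
        (if i = 0 then -(b 0 1 1 x y + b 1 0 1 x y) else 2 * b 0 0 1 x y)) := by
      intro i j
      refine ⟨_, ?_, rfl⟩
      fin_cases i <;> fin_cases j <;> simp only [cofM, Fin.zero_eta, Fin.mk_one, if_true,
        one_ne_zero, if_false]
      exacts [hCy, hBy.fun_neg, hBy.fun_neg, hAy]
    obtain ⟨m0, hm0, em0⟩ := c0 0 j
    obtain ⟨m1, hm1, em1⟩ := c0 1 j
    obtain ⟨n0, hn0, en0⟩ := c1 0 j
    obtain ⟨n1, hn1, en1⟩ := c1 1 j
    have P0 := (cof_deriv _ _ _ _ _ _ x hAx hBx hCx _ _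
      ((hm0.fun_mul (h0 0 i)).fun_add (hm1.fun_mul (h0 1 i))).fun_neg hD).deriv
    have P1 := (cof_deriv _ _ _ _ _ _ y hAy hBy hCy _ _
      ((hn0.fun_mul (h1 0 i)).fun_add (hn1.fun_mul (h1 1 i))).fun_neg hD).deriv
    have Q0 : pd 0 (christoffel g i 1 j) x y = _ :=
      (pd_zero _ _ _).trans ((Filter.EventuallyEq.deriv_eq (hgx i 1 j)).trans P0)
    have Q1 : pd 1 (christoffel g i 0 j) x y = _ :=
      (pd_one _ _ _).trans ((Filter.EventuallyEq.deriv_eq (hgy i 0 j)).trans P1)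
    have S0 := hS 0 i
    have S1 := hS 1 i
    unfold riemann
    rw [Q0, Q1, em0, em1, en0, en1]
    simp only [hg, Fin.sum_univ_two, gamM]
    clear P0 P1 Q0 Q1 hm0 hm1 hn0 hn1 em0 em1 en0 en1 hAx hAy hBx hBy hCx hCy h0 h1 hg hgx hgy hS c0 c1
    fin_cases i <;> fin_cases j <;>
    simp only [Fin.zero_eta, Fin.mk_one, cofM, if_true, one_ne_zero, if_false] at S0 S1 ⊢ <;>
    generalize A x y = A at * <;> generalize B x y = B at * <;> generalize C x y = C at * <;>
    generalize b 0 0 0 x y = b000 at * <;> generalize b 0 0 1 x y = b001 at * <;>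
    generalize b 0 1 0 x y = b010 at * <;> generalize b 0 1 1 x y = b011 at * <;>
    generalize b 1 0 0 x y = b100 at * <;> generalize b 1 0 1 x y = b101 at * <;>
    generalize b 1 1 0 x y = b110 at * <;> generalize b 1 1 1 x y = b111 at *
    · field_simp
      refine div_eq_zero_iff.mpr (Or.inl ?_)
      linear_combination (-C) * S0 + B * S1
    · field_simp
      linear_combination (B) * S0 - A * S1
    · field_simp
      refine div_eq_zero_iff.mpr (Or.inl ?_)
      linear_combination (-C) * S0 + B * S1
    · field_simp
      linear_combination (B) * S0 - A * S1
  have anti : riemann g i j k l x y = - riemann g i j l k x y := by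
    simp only [riemann, Fin.sum_univ_two]; ring
  fin_cases k <;> fin_cases l
  · simp only [riemann, Fin.sum_univ_two]; ring
  · exact key i j
  · rw [anti]; simpa using key i j
  · simp only [riemann, Fin.sum_univ_two]; ring

section concrete

/-- The contravariant Christoffel symbols `b^{si}_k`, linear in the parameters. -/
noncomputable def bM (c₁ c₂ c₃ c₄ c₅ : ℝ) (s i k : Fin 2) (x y : ℝ) : ℝ :=
  if s = 0 then
    (if i = 0 then (if k = 0 then c₁ / 2 else c₂ / 2)
      else (if k = 0 then c₄ else -c₁ / 2))
  else
    (if i = 0 then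
      (if k = 0 then (c₂ / 2 - c₃ * y - c₂ * y ^ 2 / 2) / x ^ 2
        else (c₃ + c₂ * y) / x + c₁ / 2)
      else (if k = 0 then (c₁ * y ^ 2 - c₁ - c₅ * y) / (2 * x ^ 2)
        else c₄ + (c₅ / 2 - c₁ * y) / x))

variable (c₁ c₂ c₃ c₄ c₅ c₆ : ℝ)

theorem hasDeriv_Ax (x y : ℝ) :
    HasDerivAt (fun a => c₁ * a + c₂ * y + c₃) (2 * bM c₁ c₂ c₃ c₄ c₅ 0 0 0 x y) x := by
  have := (((hasDerivAt_id x).const_mul c₁).add_const (c₂ * y)).add_const c₃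
  refine hda_congr this (fun _ => rfl) ?_
  simp only [bM, if_true]; ring

theorem hasDeriv_Ay (x y : ℝ) :
    HasDerivAt (fun b => c₁ * x + c₂ * b + c₃) (2 * bM c₁ c₂ c₃ c₄ c₅ 0 0 1 x y) y := by
  have := (((hasDerivAt_id y).const_mul c₂).const_add (c₁ * x)).add_const c₃
  refine hda_congr this (fun _ => rfl) ?_
  simp only [bM, if_true, one_ne_zero, if_false]; ring

theorem hasDeriv_div (p x : ℝ) (hx : x ≠ 0) : HasDerivAt (fun a => p / a) (-p / x ^ 2) x := by
  have := (hasDerivAt_inv hx).const_mul p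
  refine hda_congr this (fun a => by ring) ?_
  ring

theorem hasDeriv_quad (p q r y : ℝ) :
    HasDerivAt (fun b => p + q * b + r * b ^ 2) (q + 2 * r * y) y := by
  have := (((hasDerivAt_id y).const_mul q).const_add p).add (((hasDerivAt_id y).pow 2).const_mul r)
  refine hda_congr this (fun a => by simp) ?_
  simp; ring

theorem hasDeriv_Bx (x y : ℝ) (hx : x ≠ 0) :
    HasDerivAt (fun a => c₄ * a - c₂ / (2 * a) + c₃ * y / a + c₂ * y ^ 2 / (2 * a))
      (bM c₁ c₂ c₃ c₄ c₅ 0 1 0 x y + bM c₁ c₂ c₃ c₄ c₅ 1 0 0 x y) x := by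
  have := ((hasDerivAt_id x).const_mul c₄).add
    (hasDeriv_div (-c₂ / 2 + c₃ * y + c₂ * y ^ 2 / 2) x hx)
  refine hda_congr this (fun a => ?_) ?_
  · simp only [Pi.add_apply, id]; ring
  · simp only [bM, if_true, one_ne_zero, if_false]; ring

theorem hasDeriv_By (x y : ℝ) (hx : x ≠ 0) :
    HasDerivAt (fun b => c₄ * x - c₂ / (2 * x) + c₃ * b / x + c₂ * b ^ 2 / (2 * x))
      (bM c₁ c₂ c₃ c₄ c₅ 0 1 1 x y + bM c₁ c₂ c₃ c₄ c₅ 1 0 1 x y) y := by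
  have := hasDeriv_quad (c₄ * x - c₂ / (2 * x)) (c₃ / x) (c₂ / (2 * x)) y
  refine hda_congr this (fun a => ?_) ?_
  · ring
  · simp only [bM, if_true, one_ne_zero, if_false]; field_simp; ring

theorem hasDeriv_Cx (x y : ℝ) (hx : x ≠ 0) :
    HasDerivAt (fun a => 2 * c₄ * y + c₁ / a + c₅ * y / a - c₁ * y ^ 2 / a + c₆)
      (2 * bM c₁ c₂ c₃ c₄ c₅ 1 1 0 x y) x := by
  have := (hasDeriv_div (c₁ + c₅ * y - c₁ * y ^ 2) x hx).const_add (2 * c₄ * y + c₆)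
  refine hda_congr this (fun a => ?_) ?_
  · ring
  · simp only [bM, if_true, one_ne_zero, if_false]; field_simp; ring

theorem hasDeriv_Cy (x y : ℝ) (hx : x ≠ 0) :
    HasDerivAt (fun b => 2 * c₄ * b + c₁ / x + c₅ * b / x - c₁ * b ^ 2 / x + c₆)
      (2 * bM c₁ c₂ c₃ c₄ c₅ 1 1 1 x y) y := by
  have := hasDeriv_quad (c₁ / x + c₆) (2 * c₄ + c₅ / x) (-c₁ / x) y
  refine hda_congr this (fun a => ?_) ?_
  · ring
  · simp only [bM, one_ne_zero, if_false]; ring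

/-- The common value of `∂₁ b^{si}_2 = ∂₂ b^{si}_1`. -/
noncomputable def dM (c₁ c₂ c₃ c₅ : ℝ) (x y : ℝ) (s i : Fin 2) : ℝ :=
  if s = 0 then 0 else (if i = 0 then -(c₃ + c₂ * y) / x ^ 2 else -(c₅ / 2 - c₁ * y) / x ^ 2)

theorem hasDeriv_b0 (x y : ℝ) (hx : x ≠ 0) (s i : Fin 2) :
    HasDerivAt (fun t => bM c₁ c₂ c₃ c₄ c₅ s i 1 t y) (dM c₁ c₂ c₃ c₅ x y s i) x := by
  fin_cases s <;> fin_cases i <;>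
    simp only [bM, dM, Fin.zero_eta, Fin.mk_one, if_true, one_ne_zero, if_false]
  · exact hasDerivAt_const _ _
  · exact hasDerivAt_const _ _
  · exact (hasDeriv_div _ x hx).add_const _
  · exact (hasDeriv_div _ x hx).const_add _

theorem hasDeriv_b1 (x y : ℝ) (hx : x ≠ 0) (s i : Fin 2) :
    HasDerivAt (fun t => bM c₁ c₂ c₃ c₄ c₅ s i 0 x t) (dM c₁ c₂ c₃ c₅ x y s i) y := by
  fin_cases s <;> fin_cases i <;>
    simp only [bM, dM, Fin.zero_eta, Fin.mk_one, if_true, one_ne_zero, if_false]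
  · exact hasDerivAt_const _ _
  · exact hasDerivAt_const _ _
  · refine hda_congr (hasDeriv_quad (c₂ / 2 / x ^ 2) (-c₃ / x ^ 2) (-c₂ / 2 / x ^ 2) y) (fun a => ?_) ?_
    · ring
    · ring
  · refine hda_congr (hasDeriv_quad (-c₁ / 2 / x ^ 2) (-c₅ / 2 / x ^ 2) (c₁ / 2 / x ^ 2) y) (fun a => ?_) ?_
    · ring
    · ring

end concrete

theorem T1_eq (c₁ c₂ c₃ c₄ c₅ c₆ : ℝ)
    (h1 : c₂ * c₅ + 2 * c₁ * c₃ = 0) (h2 : c₂ * c₆ - 2 * c₃ * c₄ = 0)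
    (x y : ℝ) (hx : x ≠ 0) :
    (c₁ * x + c₂ * y + c₃) * bM c₁ c₂ c₃ c₄ c₅ 1 0 0 x y
      + (c₄ * x - c₂ / (2 * x) + c₃ * y / x + c₂ * y ^ 2 / (2 * x)) * bM c₁ c₂ c₃ c₄ c₅ 1 0 1 x y
    = (c₄ * x - c₂ / (2 * x) + c₃ * y / x + c₂ * y ^ 2 / (2 * x)) * bM c₁ c₂ c₃ c₄ c₅ 0 0 0 x y
      + (2 * c₄ * y + c₁ / x + c₅ * y / x - c₁ * y ^ 2 / x + c₆) * bM c₁ c₂ c₃ c₄ c₅ 0 0 1 x y := by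
  simp only [bM, if_true, one_ne_zero, if_false]
  field_simp
  linear_combination (-2 * x * y) * h1 - (2 * x ^ 2) * h2

theorem T2_eq (c₁ c₂ c₃ c₄ c₅ c₆ : ℝ)
    (h1 : c₂ * c₅ + 2 * c₁ * c₃ = 0) (h3 : c₁ * c₆ + c₄ * c₅ = 0)
    (x y : ℝ) (hx : x ≠ 0) :
    (c₁ * x + c₂ * y + c₃) * bM c₁ c₂ c₃ c₄ c₅ 1 1 0 x y
      + (c₄ * x - c₂ / (2 * x) + c₃ * y / x + c₂ * y ^ 2 / (2 * x)) * bM c₁ c₂ c₃ c₄ c₅ 1 1 1 x y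
    = (c₄ * x - c₂ / (2 * x) + c₃ * y / x + c₂ * y ^ 2 / (2 * x)) * bM c₁ c₂ c₃ c₄ c₅ 0 1 0 x y
      + (2 * c₄ * y + c₁ / x + c₅ * y / x - c₁ * y ^ 2 / x + c₆) * bM c₁ c₂ c₃ c₄ c₅ 0 1 1 x y := by
  simp only [bM, if_true, one_ne_zero, if_false]
  field_simp
  linear_combination (2 * x ^ 2) * h3 - (y ^ 2 + 1) * h1

theorem S_eq (c₁ c₂ c₃ c₄ c₅ c₆ : ℝ)
    (h1 : c₂ * c₅ + 2 * c₁ * c₃ = 0) (h2 : c₂ * c₆ - 2 * c₃ * c₄ = 0)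
    (h3 : c₁ * c₆ + c₄ * c₅ = 0)
    (x y : ℝ) (hx : x ≠ 0) (A B C : ℝ) (hA : A = c₁ * x + c₂ * y + c₃)
    (hB : B = c₄ * x - c₂ / (2 * x) + c₃ * y / x + c₂ * y ^ 2 / (2 * x))
    (hC : C = 2 * c₄ * y + c₁ / x + c₅ * y / x - c₁ * y ^ 2 / x + c₆)
    (b : Fin 2 → Fin 2 → Fin 2 → ℝ → ℝ → ℝ) (hb : b = bM c₁ c₂ c₃ c₄ c₅) :
    C * (b 0 0 0 x y * b 0 1 1 x y - b 0 0 1 x y * b 0 1 0 x y)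
      - B * (b 0 0 0 x y * b 1 1 1 x y - b 0 0 1 x y * b 1 1 0 x y)
      - B * (b 1 0 0 x y * b 0 1 1 x y - b 1 0 1 x y * b 0 1 0 x y)
      + A * (b 1 0 0 x y * b 1 1 1 x y - b 1 0 1 x y * b 1 1 0 x y) = 0 := by
  subst hA hB hC hb
  simp only [bM, if_true, one_ne_zero, if_false]
  field_simp
  ring_nf
  grind

/-- **Theorem 4 of the paper (flatness part).** If the parameters `c₁,…,c₆`
satisfy the Levi-Civita conditions (eq:18), then the contravariant metric
`g¹¹ = c₁u¹ + c₂u² + c₃`,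
`g¹² = g²¹ = c₄u¹ − c₂/(2u¹) + c₃u²/u¹ + c₂(u²)²/(2u¹)`,
`g²² = 2c₄u² + c₁/u¹ + c₅u²/u¹ − c₁(u²)²/u¹ + c₆` is flat at every point where
`u¹ ≠ 0` and the metric is non-degenerate. -/
theorem flat_R3_3_metric (c₁ c₂ c₃ c₄ c₅ c₆ : ℝ)
    (h1 : c₂ * c₅ + 2 * c₁ * c₃ = 0)
    (h2 : c₂ * c₆ - 2 * c₃ * c₄ = 0)
    (h3 : c₁ * c₆ + c₄ * c₅ = 0) :
    ∀ x y : ℝ, x ≠ 0 →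
      Matrix.det (!![c₁ * x + c₂ * y + c₃,
        c₄ * x - c₂ / (2 * x) + c₃ * y / x + c₂ * y ^ 2 / (2 * x);
        c₄ * x - c₂ / (2 * x) + c₃ * y / x + c₂ * y ^ 2 / (2 * x),
        2 * c₄ * y + c₁ / x + c₅ * y / x - c₁ * y ^ 2 / x + c₆]) ≠ 0 →
      ∀ i j k l : Fin 2,
        riemann (fun a b => !![c₁ * a + c₂ * b + c₃,
          c₄ * a - c₂ / (2 * a) + c₃ * b / a + c₂ * b ^ 2 / (2 * a);
          c₄ * a - c₂ / (2 * a) + c₃ * b / a + c₂ * b ^ 2 / (2 * a),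
          2 * c₄ * b + c₁ / a + c₅ * b / a - c₁ * b ^ 2 / a + c₆]) i j k l x y = 0 := by
  intro x y hx hdet
  let A : ℝ → ℝ → ℝ := fun a b => c₁ * a + c₂ * b + c₃
  let B : ℝ → ℝ → ℝ := fun a b =>
    c₄ * a - c₂ / (2 * a) + c₃ * b / a + c₂ * b ^ 2 / (2 * a)
  let C : ℝ → ℝ → ℝ := fun a b =>
    2 * c₄ * b + c₁ / a + c₅ * b / a - c₁ * b ^ 2 / a + c₆
  have hD : A x y * C x y - B x y ^ 2 ≠ 0 := by
    rw [Matrix.det_fin_two_of] at hdet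
    rw [sq]; exact hdet
  have hchr : ∀ a b, a ≠ 0 → A a b * C a b - B a b ^ 2 ≠ 0 → ∀ i k j,
      christoffel (fun a b => !![A a b, B a b; B a b, C a b]) i k j a b
        = gamM A B C (bM c₁ c₂ c₃ c₄ c₅) i k j a b := by
    intro a b ha hab i k j
    exact chr_eq A B C (bM c₁ c₂ c₃ c₄ c₅) a b (hasDeriv_Ax _ _ _ _ _ a b)
      (hasDeriv_Ay _ _ _ _ _ a b) (hasDeriv_Bx _ _ _ _ _ a b ha) (hasDeriv_By _ _ _ _ _ a b ha)
      (hasDeriv_Cx _ _ _ _ _ _ a b ha) (hasDeriv_Cy _ _ _ _ _ _ a b ha) hab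
      (T1_eq _ _ _ _ _ _ h1 h2 a b ha) (T2_eq _ _ _ _ _ _ h1 h3 a b ha) i k j
  have hAx := hasDeriv_Ax c₁ c₂ c₃ c₄ c₅ x y
  have hAy := hasDeriv_Ay c₁ c₂ c₃ c₄ c₅ x y
  have hBx := hasDeriv_Bx c₁ c₂ c₃ c₄ c₅ x y hx
  have hBy := hasDeriv_By c₁ c₂ c₃ c₄ c₅ x y hx
  have hCx := hasDeriv_Cx c₁ c₂ c₃ c₄ c₅ c₆ x y hx
  have hCy := hasDeriv_Cy c₁ c₂ c₃ c₄ c₅ c₆ x y hx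
  have hDx : ∀ᶠ s in nhds x, A s y * C s y - B s y ^ 2 ≠ 0 :=
    ((hAx.continuousAt.mul hCx.continuousAt).sub (hBx.continuousAt.pow 2)).eventually_ne hD
  have hDy : ∀ᶠ s in nhds y, A x s * C x s - B x s ^ 2 ≠ 0 :=
    ((hAy.continuousAt.mul hCy.continuousAt).sub (hBy.continuousAt.pow 2)).eventually_ne hD
  have S := S_eq c₁ c₂ c₃ c₄ c₅ c₆ h1 h2 h3 x y hx (A x y) (B x y) (C x y) rfl rfl rfl _ rfl
  intro i j k l
  refine riem_zero A B C (bM c₁ c₂ c₃ c₄ c₅) x y (dM c₁ c₂ c₃ c₅ x y) (dM c₁ c₂ c₃ c₅ x y)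
    hAx hAy hBx hBy hCx hCy (hasDeriv_b0 c₁ c₂ c₃ c₄ c₅ x y hx)
    (hasDeriv_b1 c₁ c₂ c₃ c₄ c₅ x y hx) hD _ (hchr x y hx hD) ?_ ?_ ?_ i j k l
  · intro i k j
    filter_upwards [hDx, eventually_ne_nhds hx] with s hs hs0 using hchr s y hs0 hs i k j
  · intro i k j
    filter_upwards [hDy] with s hs using hchr x s hx hs i k j
  · intro a i
    fin_cases a <;> fin_cases i <;> simp only [Fin.zero_eta, Fin.mk_one]
    · ring
    · linear_combination -S
    · linear_combination S
    · ring
end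

section
/- The contravariant metric on the open set {(u¹,u²) ∈ ℝ² : u¹ ≠ 0} with components ℓ¹¹ = 0, ℓ¹² = ℓ²¹ = 1/u¹, ℓ²² = 2u²/(u¹)² (which has det(ℓ^{ij}) = −1/(u¹)² ≠ 0) is flat. -/
open Matrix

/-- The metric of the theorem. -/
noncomputable def ellMetric : ℝ → ℝ → Matrix (Fin 2) (Fin 2) ℝ :=
  fun a b => !![(0 : ℝ), 1 / a; 1 / a, 2 * b / a ^ 2]

/-- Its covariant components away from `u¹ = 0`. -/
def ellCov (l k : Fin 2) (x y : ℝ) : ℝ :=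
  !![-2 * y, x; x, 0] l k

/-- Its Christoffel symbols away from `u¹ = 0`. -/
noncomputable def ellGamma (i j k : Fin 2) (x y : ℝ) : ℝ :=
  if i = 0 then !![2 / x, 0; 0, 0] j k else !![4 * y / x ^ 2, -1 / x; -1 / x, 0] j k

theorem pd_congr_ne (i : Fin 2) {f h : ℝ → ℝ → ℝ} (H : ∀ x y, x ≠ 0 → f x y = h x y)
    {x y : ℝ} (hx : x ≠ 0) : pd i f x y = pd i h x y := by
  unfold pd
  split_ifs
  · apply Filter.EventuallyEq.deriv_eq
    filter_upwards [isOpen_ne.mem_nhds hx] with s hs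
    exact H s y hs
  · congr 1
    funext s
    exact H x s hx

theorem covMetric_ell (l k : Fin 2) (x y : ℝ) (hx : x ≠ 0) :
    covMetric ellMetric l k x y = ellCov l k x y := by
  have h : (ellMetric x y)⁻¹ = !![-2 * y, x; x, 0] := by
    apply Matrix.inv_eq_right_inv
    ext i j
    fin_cases i <;> fin_cases j <;> simp [ellMetric, Matrix.mul_apply, Fin.sum_univ_two, hx]
    field_simp
    ring
  simp only [covMetric, ellCov, h]

theorem christoffel_ell (i j k : Fin 2) (x y : ℝ) (hx : x ≠ 0) :
    christoffel ellMetric i j k x y = ellGamma i j k x y := by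
  have hpd : ∀ m l k, pd m (covMetric ellMetric l k) x y = pd m (ellCov l k) x y :=
    fun m l k => pd_congr_ne m (covMetric_ell l k) hx
  have h1 : deriv (fun s : ℝ => 2 * s) y = 2 := by
    simpa using ((hasDerivAt_id y).const_mul 2).deriv
  simp only [christoffel, hpd, Fin.sum_univ_two]
  fin_cases i <;> fin_cases j <;> fin_cases k <;>
    simp [pd, ellCov, ellGamma, ellMetric, h1] <;> field_simp <;> ring

/-- The leading-term metric `ℓ⁽²⁾` of the third-order operator `R₃⁽²⁾`,
`ℓ¹¹ = 0`, `ℓ¹² = ℓ²¹ = 1/u¹`, `ℓ²² = 2u²/(u¹)²`, is flat on `{u¹ ≠ 0}`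
(where its determinant `−1/(u¹)²` is non-zero). -/
theorem flat_leading_metric_R3_2 :
    ∀ x y : ℝ, x ≠ 0 →
      (Matrix.det (!![(0 : ℝ), 1 / x; 1 / x, 2 * y / x ^ 2]) = -(1 / x ^ 2) ∧
        Matrix.det (!![(0 : ℝ), 1 / x; 1 / x, 2 * y / x ^ 2]) ≠ 0) ∧
      ∀ i j k l : Fin 2,
        riemann (fun a b => !![(0 : ℝ), 1 / a; 1 / a, 2 * b / a ^ 2])
          i j k l x y = 0 := by
  intro x y hx
  have hdet : Matrix.det (!![(0 : ℝ), 1 / x; 1 / x, 2 * y / x ^ 2]) = -(1 / x ^ 2) := by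
    rw [Matrix.det_fin_two_of]
    field_simp
    ring
  refine ⟨⟨hdet, ?_⟩, ?_⟩
  · rw [hdet]
    exact neg_ne_zero.mpr (one_div_ne_zero (pow_ne_zero 2 hx))
  · intro i j k l
    change riemann ellMetric i j k l x y = 0
    have hG : ∀ i j k, christoffel ellMetric i j k x y = ellGamma i j k x y :=
      fun i j k => christoffel_ell i j k x y hx
    unfold riemann
    rw [pd_congr_ne k (christoffel_ell i l j) hx, pd_congr_ne l (christoffel_ell i k j) hx]
    simp only [hG, Fin.sum_univ_two]
    have h1 : deriv (fun s : ℝ => 2 / s) x = -2 / x ^ 2 := by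
      have := ((hasDerivAt_const x (2 : ℝ)).div (hasDerivAt_id x) hx).deriv
      simpa [Pi.div_def] using this
    have h2 : deriv (fun s : ℝ => -1 / s) x = 1 / x ^ 2 := by
      have := ((hasDerivAt_const x (-1 : ℝ)).div (hasDerivAt_id x) hx).deriv
      simpa [Pi.div_def] using this
    have h3 : deriv (fun s : ℝ => 4 * s / x ^ 2) y = 4 / x ^ 2 := by
      have := (((hasDerivAt_id y).const_mul 4).div_const (x ^ 2)).deriv
      simpa using this
    fin_cases i <;> fin_cases j <;> fin_cases k <;> fin_cases l <;>
      simp [pd, ellGamma, h1, h2, h3] <;> field_simp <;> ring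
end

section
/- Let c = (c₁,…,c₇) and d = (d₁,…,d₇) in ℝ⁷ satisfy c₂ ≠ 0, c₆ = c₁c₄/c₂, c₇ = c₃c₄/c₂ and d₂ ≠ 0, d₆ = d₁d₄/d₂, d₇ = d₃d₄/d₂. Then the point c − λd satisfies the equations e₁e₄ − e₂e₆ = 0, e₃e₄ − e₂e₇ = 0, e₃e₆ − e₁e₇ = 0 (with eᵢ = cᵢ − λdᵢ) for every λ ∈ ℝ if and only if c₄d₂ = d₄c₂, or both d₃c₂ = d₂c₃ and c₁d₂ = d₁c₂. -/
/-- **Case `g_{λ,11}` of Theorem 5 (th2d-anti) of the paper.** Both endpoints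
lie in case 1 of the variety (eq:165). The line `λ ↦ c − λd` lies entirely in
the variety iff `c₄d₂ = d₄c₂`, or both `d₃c₂ = d₂c₃` and `c₁d₂ = d₁c₂`. -/
theorem pencil_R3_1_g11 (c₁ c₂ c₃ c₄ c₅ c₆ c₇ d₁ d₂ d₃ d₄ d₅ d₆ d₇ : ℝ)
    (hc2 : c₂ ≠ 0) (hc6 : c₆ = c₁ * c₄ / c₂) (hc7 : c₇ = c₃ * c₄ / c₂)
    (hd2 : d₂ ≠ 0) (hd6 : d₆ = d₁ * d₄ / d₂) (hd7 : d₇ = d₃ * d₄ / d₂) :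
    (∀ lam : ℝ,
      (c₁ - lam * d₁) * (c₄ - lam * d₄) - (c₂ - lam * d₂) * (c₆ - lam * d₆) = 0 ∧
      (c₃ - lam * d₃) * (c₄ - lam * d₄) - (c₂ - lam * d₂) * (c₇ - lam * d₇) = 0 ∧
      (c₃ - lam * d₃) * (c₆ - lam * d₆) - (c₁ - lam * d₁) * (c₇ - lam * d₇) = 0) ↔
    (c₄ * d₂ = d₄ * c₂ ∨ (d₃ * c₂ = d₂ * c₃ ∧ c₁ * d₂ = d₁ * c₂)) := by
  obtain ⟨s, hs⟩ : ∃ s, c₄ = s * c₂ := ⟨c₄ / c₂, by field_simp⟩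
  obtain ⟨t, ht⟩ : ∃ t, d₄ = t * d₂ := ⟨d₄ / d₂, by field_simp⟩
  have h6 : c₆ = s * c₁ := by rw [hc6, hs]; field_simp
  have h7 : c₇ = s * c₃ := by rw [hc7, hs]; field_simp
  have k6 : d₆ = t * d₁ := by rw [hd6, ht]; field_simp
  have k7 : d₇ = t * d₃ := by rw [hd7, ht]; field_simp
  clear hc6 hc7 hd6 hd7
  subst hs ht h6 h7 k6 k7
  constructor
  · intro h
    obtain ⟨h1, h2, -⟩ := h 1
    have e1 : (s - t) * (c₁ * d₂ - d₁ * c₂) = 0 := by linear_combination h1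
    have e2 : (s - t) * (d₃ * c₂ - d₂ * c₃) = 0 := by linear_combination -h2
    by_cases hst : s - t = 0
    · left
      linear_combination c₂ * d₂ * hst
    · right
      exact ⟨sub_eq_zero.mp ((mul_eq_zero.mp e2).resolve_left hst),
        sub_eq_zero.mp ((mul_eq_zero.mp e1).resolve_left hst)⟩
  · rintro (h | ⟨ha, hb⟩) lam
    · have hst : s = t := by
        apply mul_right_cancel₀ (mul_ne_zero hc2 hd2)
        linear_combination h
      subst hst
      refine ⟨by ring, by ring, by ring⟩
    · have hc : c₃ * d₁ - c₁ * d₃ = 0 := by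
        apply (mul_eq_zero.mp (_ : c₂ * (c₃ * d₁ - c₁ * d₃) = 0)).resolve_left hc2
        linear_combination -c₃ * hb - c₁ * ha
      refine ⟨?_, ?_, ?_⟩
      · linear_combination lam * (s - t) * hb
      · linear_combination -lam * (s - t) * ha
      · linear_combination lam * (s - t) * hc
end

section
/- Let c = (c₁,…,c₇) and d = (d₁,…,d₇) in ℝ⁷ satisfy c₂ ≠ 0, c₆ = c₁c₄/c₂, c₇ = c₃c₄/c₂ and d₂ = 0, d₃ ≠ 0, d₄ = 0, d₆ = d₁d₇/d₃. Then the point c − λd satisfies the equations e₁e₄ − e₂e₆ = 0, e₃e₄ − e₂e₇ = 0, e₃e₆ − e₁e₇ = 0 (with eᵢ = cᵢ − λdᵢ) for every λ ∈ ℝ if and only if d₇ = d₃c₄/c₂. -/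
/-- **Case `g_{λ,12}` of Theorem 5 (th2d-anti) of the paper.** The endpoints
lie in cases 1 and 2 of the variety (eq:165). The line `λ ↦ c − λd` lies
entirely in the variety iff `d₇ = d₃c₄/c₂`. -/
theorem pencil_R3_1_g12 (c₁ c₂ c₃ c₄ c₅ c₆ c₇ d₁ d₂ d₃ d₄ d₅ d₆ d₇ : ℝ)
    (hc2 : c₂ ≠ 0) (hc6 : c₆ = c₁ * c₄ / c₂) (hc7 : c₇ = c₃ * c₄ / c₂)
    (hd2 : d₂ = 0) (hd3 : d₃ ≠ 0) (hd4 : d₄ = 0) (hd6 : d₆ = d₁ * d₇ / d₃) :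
    (∀ lam : ℝ,
      (c₁ - lam * d₁) * (c₄ - lam * d₄) - (c₂ - lam * d₂) * (c₆ - lam * d₆) = 0 ∧
      (c₃ - lam * d₃) * (c₄ - lam * d₄) - (c₂ - lam * d₂) * (c₇ - lam * d₇) = 0 ∧
      (c₃ - lam * d₃) * (c₆ - lam * d₆) - (c₁ - lam * d₁) * (c₇ - lam * d₇) = 0) ↔
    d₇ = d₃ * c₄ / c₂ := by
  subst hd2 hd4
  constructor
  · intro h
    have h1 := (h 1).2.1
    have h7 : c₇ * c₂ = c₃ * c₄ := by rw [hc7]; field_simp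
    rw [eq_div_iff hc2]
    linarith
  · intro h lam
    have h6 : d₆ = d₁ * c₄ / c₂ := by rw [hd6, h]; field_simp
    rw [hc6, hc7, h6, h]
    refine ⟨?_, ?_, ?_⟩ <;> field_simp <;> ring
end

section
/- Let c = (c₁,…,c₇) and d = (d₁,…,d₇) in ℝ⁷ satisfy c₂ ≠ 0, c₆ = c₁c₄/c₂, c₇ = c₃c₄/c₂ and d₁ = d₂ = d₃ = 0. Then the point c − λd satisfies the equations e₁e₄ − e₂e₆ = 0, e₃e₄ − e₂e₇ = 0, e₃e₆ − e₁e₇ = 0 (with eᵢ = cᵢ − λdᵢ) for every λ ∈ ℝ if and only if d₆ = d₄c₁/c₂ and d₇ = d₄c₃/c₂. -/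
/-- **Case `g_{λ,13}` of Theorem 5 (th2d-anti) of the paper.** The endpoints
lie in cases 1 and 3 of the variety (eq:165). The line `λ ↦ c − λd` lies
entirely in the variety iff `d₆ = d₄c₁/c₂` and `d₇ = d₄c₃/c₂`. -/
theorem pencil_R3_1_g13 (c₁ c₂ c₃ c₄ c₅ c₆ c₇ d₁ d₂ d₃ d₄ d₅ d₆ d₇ : ℝ)
    (hc2 : c₂ ≠ 0) (hc6 : c₆ = c₁ * c₄ / c₂) (hc7 : c₇ = c₃ * c₄ / c₂)
    (hd1 : d₁ = 0) (hd2 : d₂ = 0) (hd3 : d₃ = 0) :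
    (∀ lam : ℝ,
      (c₁ - lam * d₁) * (c₄ - lam * d₄) - (c₂ - lam * d₂) * (c₆ - lam * d₆) = 0 ∧
      (c₃ - lam * d₃) * (c₄ - lam * d₄) - (c₂ - lam * d₂) * (c₇ - lam * d₇) = 0 ∧
      (c₃ - lam * d₃) * (c₆ - lam * d₆) - (c₁ - lam * d₁) * (c₇ - lam * d₇) = 0) ↔
    (d₆ = d₄ * c₁ / c₂ ∧ d₇ = d₄ * c₃ / c₂) := by
  subst hd1 hd2 hd3
  have h6 : c₂ * c₆ = c₁ * c₄ := by rw [hc6]; field_simp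
  have h7 : c₂ * c₇ = c₃ * c₄ := by rw [hc7]; field_simp
  constructor
  · intro h
    obtain ⟨h1, h2, -⟩ := h 1
    constructor
    · rw [eq_div_iff hc2]; linarith
    · rw [eq_div_iff hc2]; linarith
  · rintro ⟨rfl, rfl⟩ lam
    subst hc6 hc7
    refine ⟨?_, ?_, ?_⟩ <;> field_simp <;> ring
end

section
/- Let c = (c₁,…,c₆) and d = (d₁,…,d₆) in ℝ⁶ satisfy c₁ ≠ 0, c₅ = 0, c₃ = −c₂c₆/(2c₁) and d₁ ≠ 0, d₅ = 0, d₃ = −d₂d₆/(2d₁). Then the point c − λd satisfies the equations e₂e₆ + 2e₁e₃ = 0, e₂e₅ = 0, e₁e₅ = 0 (with eᵢ = cᵢ − λdᵢ) for every λ ∈ ℝ if and only if d₆ = d₁c₆/c₁ or d₂ = d₁c₂/c₁. -/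
/-- **Case `g_{λ,11}` of Theorem 6 (th3d) of the paper.** Both endpoints lie
in case 1 of the variety (eq:17). The line `λ ↦ c − λd` lies entirely in the
variety iff `d₆ = d₁c₆/c₁` or `d₂ = d₁c₂/c₁`. -/
theorem pencil_R3_2_g11 (c₁ c₂ c₃ c₄ c₅ c₆ d₁ d₂ d₃ d₄ d₅ d₆ : ℝ)
    (hc1 : c₁ ≠ 0) (hc5 : c₅ = 0) (hc3 : c₃ = -(c₂ * c₆) / (2 * c₁))
    (hd1 : d₁ ≠ 0) (hd5 : d₅ = 0) (hd3 : d₃ = -(d₂ * d₆) / (2 * d₁)) :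
    (∀ lam : ℝ,
      (c₂ - lam * d₂) * (c₆ - lam * d₆) + 2 * (c₁ - lam * d₁) * (c₃ - lam * d₃) = 0 ∧
      (c₂ - lam * d₂) * (c₅ - lam * d₅) = 0 ∧
      (c₁ - lam * d₁) * (c₅ - lam * d₅) = 0) ↔
    (d₆ = d₁ * c₆ / c₁ ∨ d₂ = d₁ * c₂ / c₁) := by
  have key : ∀ lam : ℝ, c₁ * d₁ * ((c₂ - lam * d₂) * (c₆ - lam * d₆)
      + 2 * (c₁ - lam * d₁) * (c₃ - lam * d₃))
      = lam * ((c₁ * d₆ - d₁ * c₆) * (c₁ * d₂ - d₁ * c₂)) := by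
    intro lam
    rw [hc3, hd3]
    field_simp
    ring
  subst hc5 hd5
  rw [eq_div_iff hc1, eq_div_iff hc1]
  constructor
  · intro h
    have h1 := key 1
    rw [(h 1).1, mul_zero, one_mul] at h1
    rcases mul_eq_zero.mp h1.symm with h2 | h2
    · left; linarith
    · right; linarith
  · intro h lam
    refine ⟨?_, by ring, by ring⟩
    have h1 := key lam
    have h2 : (c₁ * d₆ - d₁ * c₆) * (c₁ * d₂ - d₁ * c₂) = 0 := by
      rcases h with h | h
      · exact mul_eq_zero_of_left (by linarith) _
      · exact mul_eq_zero_of_right _ (by linarith)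
    rw [h2, mul_zero] at h1
    exact (mul_eq_zero.mp h1).resolve_left (mul_ne_zero hc1 hd1)
end

section
/- Let c = (c₁,…,c₆) and d = (d₁,…,d₆) in ℝ⁶ satisfy c₂ ≠ 0, c₅ = −2c₁c₃/c₂, c₆ = 2c₃c₄/c₂ and d₂ ≠ 0, d₅ = −2d₁d₃/d₂, d₆ = 2d₃d₄/d₂. Then the point c − λd satisfies the equations e₂e₅ + 2e₁e₃ = 0, e₂e₆ − 2e₃e₄ = 0, e₁e₆ + e₄e₅ = 0 (with eᵢ = cᵢ − λdᵢ) for every λ ∈ ℝ if and only if d₃ = d₂c₃/c₂, or both d₁ = d₂c₁/c₂ and d₄ = d₂c₄/c₂. -/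
/-- **Case `g_{λ,11}` of Theorem 7 (th4d) of the paper.** Both endpoints lie
in case 1 of the variety (eq:18). The line `λ ↦ c − λd` lies entirely in the
variety iff `d₃ = d₂c₃/c₂`, or both `d₁ = d₂c₁/c₂` and `d₄ = d₂c₄/c₂`. -/
theorem pencil_R3_3_g11 (c₁ c₂ c₃ c₄ c₅ c₆ d₁ d₂ d₃ d₄ d₅ d₆ : ℝ)
    (hc2 : c₂ ≠ 0) (hc5 : c₅ = -(2 * c₁ * c₃) / c₂) (hc6 : c₆ = 2 * c₃ * c₄ / c₂)
    (hd2 : d₂ ≠ 0) (hd5 : d₅ = -(2 * d₁ * d₃) / d₂) (hd6 : d₆ = 2 * d₃ * d₄ / d₂) :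
    (∀ lam : ℝ,
      (c₂ - lam * d₂) * (c₅ - lam * d₅) + 2 * (c₁ - lam * d₁) * (c₃ - lam * d₃) = 0 ∧
      (c₂ - lam * d₂) * (c₆ - lam * d₆) - 2 * (c₃ - lam * d₃) * (c₄ - lam * d₄) = 0 ∧
      (c₁ - lam * d₁) * (c₆ - lam * d₆) + (c₄ - lam * d₄) * (c₅ - lam * d₅) = 0) ↔
    (d₃ = d₂ * c₃ / c₂ ∨ (d₁ = d₂ * c₁ / c₂ ∧ d₄ = d₂ * c₄ / c₂)) := by
  obtain ⟨a₁, rfl⟩ : ∃ a, c₁ = c₂ * a := ⟨c₁ / c₂, by field_simp⟩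
  obtain ⟨a₃, rfl⟩ : ∃ a, c₃ = c₂ * a := ⟨c₃ / c₂, by field_simp⟩
  obtain ⟨a₄, rfl⟩ : ∃ a, c₄ = c₂ * a := ⟨c₄ / c₂, by field_simp⟩
  obtain ⟨b₁, rfl⟩ : ∃ a, d₁ = d₂ * a := ⟨d₁ / d₂, by field_simp⟩
  obtain ⟨b₃, rfl⟩ : ∃ a, d₃ = d₂ * a := ⟨d₃ / d₂, by field_simp⟩
  obtain ⟨b₄, rfl⟩ : ∃ a, d₄ = d₂ * a := ⟨d₄ / d₂, by field_simp⟩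
  have e5 : c₅ = -2 * c₂ * a₁ * a₃ := by rw [hc5]; field_simp
  have e6 : c₆ = 2 * c₂ * a₃ * a₄ := by rw [hc6]; field_simp
  have f5 : d₅ = -2 * d₂ * b₁ * b₃ := by rw [hd5]; field_simp
  have f6 : d₆ = 2 * d₂ * b₃ * b₄ := by rw [hd6]; field_simp
  clear hc5 hc6 hd5 hd6
  subst e5 e6 f5 f6
  have key : ∀ a b : ℝ, d₂ * b = d₂ * (c₂ * a) / c₂ ↔ b = a := by
    intro a b
    have h : d₂ * (c₂ * a) / c₂ = d₂ * a := by field_simp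
    rw [h]
    exact mul_right_inj' hd2
  rw [key, key, key]
  constructor
  · intro h
    obtain ⟨h1, h2, -⟩ := h 1
    have hcd : c₂ * d₂ ≠ 0 := mul_ne_zero hc2 hd2
    have g1 : (c₂ * d₂) * ((b₃ - a₃) * (b₁ - a₁)) = 0 := by linear_combination h1 / 2
    have g2 : (c₂ * d₂) * ((b₃ - a₃) * (b₄ - a₄)) = 0 := by linear_combination -h2 / 2
    have k1 := (mul_eq_zero.mp g1).resolve_left hcd
    have k2 := (mul_eq_zero.mp g2).resolve_left hcd
    by_cases h3 : b₃ - a₃ = 0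
    · left; linarith
    · right
      have := (mul_eq_zero.mp k1).resolve_left h3
      have := (mul_eq_zero.mp k2).resolve_left h3
      constructor <;> linarith
  · rintro (rfl | ⟨rfl, rfl⟩) lam <;> refine ⟨?_, ?_, ?_⟩ <;> ring
end

section
/- Let c = (c₁,…,c₆) and d = (d₁,…,d₆) in ℝ⁶ satisfy c₂ = c₃ = 0, c₆ ≠ 0, c₁ = −c₄c₅/c₆ and d₂ = d₃ = 0, d₆ ≠ 0, d₁ = −d₄d₅/d₆. Then the point c − λd satisfies the equations e₂e₅ + 2e₁e₃ = 0, e₂e₆ − 2e₃e₄ = 0, e₁e₆ + e₄e₅ = 0 (with eᵢ = cᵢ − λdᵢ) for every λ ∈ ℝ if and only if d₅ = d₆c₅/c₆ or d₄ = d₆c₄/c₆. -/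
/-- **Case `g_{λ,33}` of Theorem 7 (th4d) of the paper.** Both endpoints lie
in case 3 of the variety (eq:18). The line `λ ↦ c − λd` lies entirely in the
variety iff `d₅ = d₆c₅/c₆` or `d₄ = d₆c₄/c₆`. -/
theorem pencil_R3_3_g33 (c₁ c₂ c₃ c₄ c₅ c₆ d₁ d₂ d₃ d₄ d₅ d₆ : ℝ)
    (hc2 : c₂ = 0) (hc3 : c₃ = 0) (hc6 : c₆ ≠ 0) (hc1 : c₁ = -(c₄ * c₅) / c₆)
    (hd2 : d₂ = 0) (hd3 : d₃ = 0) (hd6 : d₆ ≠ 0) (hd1 : d₁ = -(d₄ * d₅) / d₆) :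
    (∀ lam : ℝ,
      (c₂ - lam * d₂) * (c₅ - lam * d₅) + 2 * (c₁ - lam * d₁) * (c₃ - lam * d₃) = 0 ∧
      (c₂ - lam * d₂) * (c₆ - lam * d₆) - 2 * (c₃ - lam * d₃) * (c₄ - lam * d₄) = 0 ∧
      (c₁ - lam * d₁) * (c₆ - lam * d₆) + (c₄ - lam * d₄) * (c₅ - lam * d₅) = 0) ↔
    (d₅ = d₆ * c₅ / c₆ ∨ d₄ = d₆ * c₄ / c₆) := by
  subst hc2 hc3 hd2 hd3
  have key : ∀ lam : ℝ, ((c₁ - lam * d₁) * (c₆ - lam * d₆)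
      + (c₄ - lam * d₄) * (c₅ - lam * d₅)) * (c₆ * d₆)
      = lam * ((c₄ * d₆ - d₄ * c₆) * (c₅ * d₆ - d₅ * c₆)) := by
    intro lam
    have h1 : c₁ * c₆ = -(c₄ * c₅) := by rw [hc1]; field_simp
    have h2 : d₁ * d₆ = -(d₄ * d₅) := by rw [hd1]; field_simp
    linear_combination (c₆ * d₆ - lam * d₆ ^ 2) * h1
      + (lam ^ 2 * c₆ * d₆ - lam * c₆ ^ 2) * h2
  rw [eq_div_iff hc6, eq_div_iff hc6]
  constructor
  · intro h
    have h3 := key 1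
    rw [(h 1).2.2, zero_mul, one_mul] at h3
    rcases mul_eq_zero.mp h3.symm with h4 | h4
    · right; linarith
    · left; linarith
  · intro h lam
    refine ⟨by ring, by ring, ?_⟩
    have h3 := key lam
    have h0 : (c₄ * d₆ - d₄ * c₆) * (c₅ * d₆ - d₅ * c₆) = 0 := by
      rcases h with h | h
      · exact mul_eq_zero_of_right _ (by linarith)
      · exact mul_eq_zero_of_left (by linarith) _
    rw [h0, mul_zero] at h3
    exact (mul_eq_zero.mp h3).resolve_right (mul_ne_zero hc6 hd6)
end
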